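/- Let λ be a partition and μ a composition with |μ| = |λ|. Then the number of semistandard Young tableaux of shape λ and content μ (the Kostka number K_{λ,μ}) equals ∑_{ {ν} } ∏_{k,n ≥ 1} C(P_n^{(k)}(λ,μ) + m_n(ν^{(k)}), m_n(ν^{(k)})), where the sum is over all configurations {ν} of type (λ, μ) and C(a, b) denotes the ordinary binomial coefficient. -/

import Mathlib

open scoped BigOperators

/-- A partition, 0-indexed: `p i` is the part `λ_{i+1}`; weakly decreasing, eventually zero. -/
def IsPartition (p : ℕ → ℕ) : Prop :=
  (∀ i, p (i + 1) ≤ p i) ∧ ∃ N, p N = 0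

/-- A composition, 0-indexed: `μ i` is the part `μ_{i+1}`; finitely many nonzero parts. -/
def IsComposition (μ : ℕ → ℕ) : Prop :=
  ∃ N, ∀ i, N ≤ i → μ i = 0

/-- `|λ| = ∑ᵢ λᵢ`. -/
noncomputable def psize (p : ℕ → ℕ) : ℕ := ∑ᶠ i, p i

/-- The conjugate: `conj p j = λ'_j = #{i : λᵢ ≥ j}` (meaningful for `j ≥ 1`). -/
noncomputable def conj (p : ℕ → ℕ) (j : ℕ) : ℕ := Nat.card {i : ℕ | j ≤ p i}

/-- `Q_n(μ) = ∑_{1 ≤ j ≤ n} μ'_j`. -/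
noncomputable def Qstat (p : ℕ → ℕ) (n : ℕ) : ℕ := ∑ j ∈ Finset.Icc 1 n, conj p j

/-- `m_n(ν) = ν'_n - ν'_{n+1}`. -/
noncomputable def mstat (p : ℕ → ℕ) (n : ℕ) : ℕ := conj p n - conj p (n + 1)

/-- `∑_{j ≥ k+1} λ_j`, where `λ_j = p (j-1)`. -/
noncomputable def tailsum (p : ℕ → ℕ) (k : ℕ) : ℕ := ∑ᶠ t : ℕ, p (t + k)

/-- `P_n^{(k)}(λ, μ) = Q_n(ν^{(k-1)}) - 2·Q_n(ν^{(k)}) + Q_n(ν^{(k+1)})`, where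
`ν^{(k)} = ν k` and `ν^{(0)} = ν 0 = μ` (meaningful for `k ≥ 1`). -/
noncomputable def Pconf (ν : ℕ → ℕ → ℕ) (k n : ℕ) : ℤ :=
  (Qstat (ν (k - 1)) n : ℤ) - 2 * Qstat (ν k) n + Qstat (ν (k + 1)) n

/-- A configuration `{ν}` of type `(λ, μ)`: `ν^{(0)} = μ`, each `ν^{(k)}` (for `k ≥ 1`) is a
partition with `|ν^{(k)}| = ∑_{j ≥ k+1} λ_j`, and `P_n^{(k)}(λ, μ) ≥ 0` for all `k, n ≥ 1`. -/
def IsConfig (p : ℕ → ℕ) (μ : ℕ → ℕ) (ν : ℕ → ℕ → ℕ) : Prop :=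
  ν 0 = μ ∧
    (∀ k, 1 ≤ k → IsPartition (ν k)) ∧
    (∀ k, 1 ≤ k → psize (ν k) = tailsum p k) ∧
    (∀ k n, 1 ≤ k → 1 ≤ n → 0 ≤ Pconf ν k n)

/-- A semistandard Young tableau of shape `λ` (0-indexed rows/columns: the box in row `r`,
column `c` belongs to the diagram iff `c < p r`) and content `μ` (0-indexed: exactly `μ i`
entries are equal to `i + 1`). -/
structure SSYTContent (p : ℕ → ℕ) (μ : ℕ → ℕ) where
  entry : ℕ → ℕ → ℕ
  pos : ∀ r c, c < p r → 1 ≤ entry r c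
  row_weak : ∀ r c₁ c₂, c₁ ≤ c₂ → c₂ < p r → entry r c₁ ≤ entry r c₂
  col_strict : ∀ r₁ r₂ c, r₁ < r₂ → c < p r₂ → entry r₁ c < entry r₂ c
  zero_outside : ∀ r c, p r ≤ c → entry r c = 0
  content : ∀ i : ℕ, Nat.card {x : ℕ × ℕ | x.2 < p x.1 ∧ entry x.1 x.2 = i + 1} = μ i

namespace RiggedConfig

/-- `∑ min(a, n)` over the lengths `a` of the strings `(a, J)` in `S`. -/
def qsum (S : Multiset (ℕ × ℕ)) (n : ℕ) : ℤ := (S.map fun x => ((min x.1 n : ℕ) : ℤ)).sum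

/-- The total length of the strings in `S`. -/
def len (S : Multiset (ℕ × ℕ)) : ℕ := (S.map Prod.fst).sum

/-- The number of strings of length `n` in `S`. -/
def cnt (S : Multiset (ℕ × ℕ)) (n : ℕ) : ℕ := S.countP (fun x => x.1 = n)

/-- The vacancy number of strings of length `n` at level `k + 1`. -/
def vac (X : ℕ → Multiset (ℕ × ℕ)) (k n : ℕ) : ℤ :=
  qsum (X k) n - 2 * qsum (X (k + 1)) n + qsum (X (k + 2)) n

/-- Level `k + 1` has a singular string of length `n`. -/
def Sing (X : ℕ → Multiset (ℕ × ℕ)) (k n : ℕ) : Prop :=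
  ∃ J : ℕ, (n, J) ∈ X (k + 1) ∧ (J : ℤ) = vac X k n

@[simp] lemma qsum_cons (x : ℕ × ℕ) (S : Multiset (ℕ × ℕ)) (n : ℕ) :
    qsum (x ::ₘ S) n = ((min x.1 n : ℕ) : ℤ) + qsum S n := by
  simp [qsum]

@[simp] lemma len_cons (x : ℕ × ℕ) (S : Multiset (ℕ × ℕ)) : len (x ::ₘ S) = x.1 + len S := by
  simp [len]

lemma qsum_second_diff (S : Multiset (ℕ × ℕ)) (n : ℕ) :
    qsum S n + qsum S (n + 2) = 2 * qsum S (n + 1) - cnt S (n + 1) := by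
  induction S using Multiset.induction_on with
  | empty => simp [qsum, cnt]
  | cons x S ih =>
    have hc : (cnt (x ::ₘ S) (n + 1) : ℤ) = cnt S (n + 1) + if x.1 = n + 1 then 1 else 0 := by
      simp only [cnt, Multiset.countP_cons]
      push_cast
      rfl
    rw [qsum_cons, qsum_cons, qsum_cons, hc]
    split_ifs <;> omega

lemma qsum_eq_len {S : Multiset (ℕ × ℕ)} {n : ℕ} (h : len S ≤ n) : qsum S n = len S := by
  induction S using Multiset.induction_on with
  | empty => simp [qsum, len]
  | cons x S ih =>
    simp only [len_cons, qsum_cons] at h ⊢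
    rw [ih (by omega)]
    omega

lemma qsum_zero (S : Multiset (ℕ × ℕ)) : qsum S 0 = 0 := by
  simp [qsum]

lemma vac_zero (X : ℕ → Multiset (ℕ × ℕ)) (k : ℕ) : vac X k 0 = 0 := by
  simp [vac, qsum_zero]

lemma fst_le_len {S : Multiset (ℕ × ℕ)} {x : ℕ × ℕ} (h : x ∈ S) : x.1 ≤ len S :=
  Multiset.le_sum_of_mem (Multiset.mem_map_of_mem _ h)

lemma cnt_pos_of_mem {S : Multiset (ℕ × ℕ)} {x : ℕ × ℕ} (h : x ∈ S) : 0 < cnt S x.1 :=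
  Multiset.countP_pos.2 ⟨x, h, rfl⟩

lemma vac_second_diff (X : ℕ → Multiset (ℕ × ℕ)) (k n : ℕ) :
    vac X k n + vac X k (n + 2) = 2 * vac X k (n + 1) - cnt (X k) (n + 1)
      + 2 * cnt (X (k + 1)) (n + 1) - cnt (X (k + 2)) (n + 1) := by
  have h0 := qsum_second_diff (X k) n
  have h1 := qsum_second_diff (X (k + 1)) n
  have h2 := qsum_second_diff (X (k + 2)) n
  simp only [vac]
  linarith

/-- `X` is a rigged configuration with `X 0 = M` for the shape `p`; each level `k ≥ 1` is padded
with strings of length zero to have exactly `B` strings. -/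
structure IsRC (B : ℕ) (p : ℕ → ℕ) (M : Multiset (ℕ × ℕ)) (X : ℕ → Multiset (ℕ × ℕ)) : Prop where
  base : X 0 = M
  card : ∀ k, (X (k + 1)).card = B
  size : ∀ k, len (X k) = tailsum p k
  nonneg : ∀ k n, 0 ≤ vac X k n
  rig : ∀ k, ∀ x ∈ X (k + 1), (x.2 : ℤ) ≤ vac X k x.1

/-- If no string of length `n` at level `k + 1` is singular, a zero vacancy number at `n`
propagates to both neighbours and excludes strings of length `n` at adjacent levels. -/
lemma IsRC.of_vac_eq_zero {B : ℕ} {p : ℕ → ℕ} {M : Multiset (ℕ × ℕ)} {X : ℕ → Multiset (ℕ × ℕ)}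
    (h : IsRC B p M X) {k n : ℕ} (hs : ¬ Sing X k (n + 1)) (hv : vac X k (n + 1) = 0) :
    vac X k n = 0 ∧ vac X k (n + 2) = 0 ∧ cnt (X k) (n + 1) = 0 ∧ cnt (X (k + 2)) (n + 1) = 0 := by
  have hc : cnt (X (k + 1)) (n + 1) = 0 := by
    by_contra hne
    obtain ⟨⟨a, J⟩, hx, rfl : a = n + 1⟩ := Multiset.countP_pos.1 (Nat.pos_of_ne_zero hne)
    have := h.rig k _ hx
    exact hs ⟨J, hx, by simp only at this; omega⟩
  have := vac_second_diff X k n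
  have := h.nonneg k n
  have := h.nonneg k (n + 2)
  omega

/-- A weakly increasing choice of lengths starting at `r`, the `k`-th one satisfying `S`. -/
def Chain (S : ℕ → ℕ → Prop) (r j : ℕ) (c : ℕ → ℕ) : Prop :=
  c 0 = r ∧ ∀ k < j, c k ≤ c (k + 1) ∧ S k (c (k + 1))

def Reach (S : ℕ → ℕ → Prop) (r j : ℕ) : Prop := ∃ c, Chain S r j c

lemma Chain.mono {S : ℕ → ℕ → Prop} {r i j : ℕ} {c : ℕ → ℕ} (h : Chain S r j c) (hij : i ≤ j) :
    Chain S r i c :=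
  ⟨h.1, fun k hk => h.2 k (by omega)⟩

lemma Chain.le {S : ℕ → ℕ → Prop} {r j : ℕ} {c : ℕ → ℕ} (h : Chain S r j c) {k : ℕ} (hk : k ≤ j) :
    r ≤ c k := by
  induction k with
  | zero => exact h.1.ge
  | succ k ih => exact (ih (by omega)).trans (h.2 k (by omega)).1

lemma Reach.mono {S : ℕ → ℕ → Prop} {r i j : ℕ} (h : Reach S r j) (hij : i ≤ j) : Reach S r i :=
  let ⟨c, hc⟩ := h
  ⟨c, hc.mono hij⟩

/-- The greedy chain, each step as small as possible, which cannot be extended. -/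
structure MinChain (S : ℕ → ℕ → Prop) (r j : ℕ) (c : ℕ → ℕ) : Prop where
  chain : Chain S r j c
  gap : ∀ k ≤ j, ∀ n, c k ≤ n → (k < j → n < c (k + 1)) → ¬ S k n

lemma Chain.exists_min {S : ℕ → ℕ → Prop} {r j : ℕ} (h : Reach S r j) (h' : ¬ Reach S r (j + 1)) :
    ∃ c, MinChain S r j c := by
  obtain ⟨d, hd⟩ := h
  let c : ℕ → ℕ := fun k => Nat.rec r (fun k a => sInf {n | a ≤ n ∧ S k n}) k
  have hc : ∀ k, c (k + 1) = sInf {n | c k ≤ n ∧ S k n} := fun k => rfl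
  have hle : ∀ k ≤ j, c k ≤ d k := by
    intro k
    induction k with
    | zero => intro _; exact hd.1.ge
    | succ k ih =>
      intro hk
      rw [hc]
      exact Nat.sInf_le ⟨(ih (by omega)).trans (hd.2 k (by omega)).1, (hd.2 k (by omega)).2⟩
  have hmem : ∀ k < j, c k ≤ c (k + 1) ∧ S k (c (k + 1)) := by
    intro k hk
    rw [hc]
    exact Nat.sInf_mem (s := {n | c k ≤ n ∧ S k n})
      ⟨d (k + 1), (hle k (by omega)).trans (hd.2 k hk).1, (hd.2 k hk).2⟩
  refine ⟨c, ⟨rfl, hmem⟩, fun k hk n hn hlt hS => ?_⟩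
  rcases hk.lt_or_eq with hk | rfl
  · have hlt := hlt hk
    rw [hc] at hlt
    exact Nat.notMem_of_lt_sInf hlt ⟨hn, hS⟩
  · refine h' ⟨Function.update c (k + 1) n, by simp; rfl, fun i hi => ?_⟩
    rcases Nat.lt_succ_iff_lt_or_eq.1 hi with hi | rfl
    · simpa [Function.update_of_ne (show i ≠ k + 1 by omega),
        Function.update_of_ne (show i + 1 ≠ k + 1 by omega)] using hmem i hi
    · simpa using ⟨hn, hS⟩

lemma MinChain.le_chain {S : ℕ → ℕ → Prop} {r j i : ℕ} {c d : ℕ → ℕ} (h : MinChain S r j c)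
    (hd : Chain S r i d) {k : ℕ} (hk : k ≤ j) (hki : k ≤ i) : c k ≤ d k := by
  induction k with
  | zero => rw [h.chain.1, hd.1]
  | succ k ih =>
    by_contra! hlt
    exact h.gap k (by omega) (d (k + 1))
      ((ih (by omega) (by omega)).trans (hd.2 k (by omega)).1) (fun _ => hlt) (hd.2 k (by omega)).2

lemma MinChain.not_reach {S : ℕ → ℕ → Prop} {r j : ℕ} {c : ℕ → ℕ} (h : MinChain S r j c) :
    ¬ Reach S r (j + 1) := by
  rintro ⟨d, hd⟩
  exact h.gap j le_rfl (d (j + 1))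
    ((h.le_chain hd le_rfl (by omega)).trans (hd.2 j (by omega)).1) (by omega) (hd.2 j (by omega)).2

lemma MinChain.rank_unique {S : ℕ → ℕ → Prop} {r i j : ℕ} {c d : ℕ → ℕ} (h : MinChain S r i c)
    (h' : MinChain S r j d) : i = j := by
  rcases lt_trichotomy i j with hlt | heq | hlt
  · exact absurd ⟨d, h'.chain.mono hlt⟩ h.not_reach
  · exact heq
  · exact absurd ⟨c, h.chain.mono hlt⟩ h'.not_reach

lemma MinChain.unique {S : ℕ → ℕ → Prop} {r j : ℕ} {c d : ℕ → ℕ} (h : MinChain S r j c)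
    (h' : MinChain S r j d) {k : ℕ} (hk : k ≤ j) : c k = d k :=
  le_antisymm (h.le_chain h'.chain hk hk) (h'.le_chain h.chain hk hk)

/-- The greedy chain built from the last step downwards, each step as large as possible. -/
structure MaxChain (S : ℕ → ℕ → Prop) (r j : ℕ) (c : ℕ → ℕ) : Prop where
  chain : Chain S r j c
  gap : ∀ k < j, ∀ n, c (k + 1) < n → (k + 1 < j → n ≤ c (k + 2)) → ¬ S k n

lemma MaxChain.unique {S : ℕ → ℕ → Prop} {r j : ℕ} {c d : ℕ → ℕ} (h : MaxChain S r j c)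
    (h' : MaxChain S r j d) {k : ℕ} (hk : k ≤ j) : c k = d k := by
  induction hi : j - k generalizing k with
  | zero =>
    obtain rfl : k = j := by omega
    rcases k with _ | k
    · rw [h.chain.1, h'.chain.1]
    · rcases lt_trichotomy (c (k + 1)) (d (k + 1)) with hlt | heq | hlt
      · exact absurd (h'.chain.2 k (by omega)).2 (h.gap k (by omega) _ hlt (by omega))
      · exact heq
      · exact absurd (h.chain.2 k (by omega)).2 (h'.gap k (by omega) _ hlt (by omega))
  | succ i ih =>
    have heq := ih (k := k + 1) (by omega) (by omega)
    rcases k with _ | k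
    · rw [h.chain.1, h'.chain.1]
    · have h1 := (h.chain.2 (k + 1) (by omega)).1
      have h2 := (h'.chain.2 (k + 1) (by omega)).1
      rcases lt_trichotomy (c (k + 1)) (d (k + 1)) with hlt | heq' | hlt
      · exact absurd (h'.chain.2 k (by omega)).2
          (h.gap k (by omega) _ hlt (fun _ => by rw [heq]; exact h2))
      · exact heq'
      · exact absurd (h.chain.2 k (by omega)).2
          (h'.gap k (by omega) _ hlt (fun _ => by rw [← heq]; exact h1))

lemma exists_maxChain_le {S : ℕ → ℕ → Prop} {r j : ℕ} (b : ℕ) {d : ℕ → ℕ} (hd : Chain S r j d)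
    (hb : d j ≤ b) : ∃ c, c (j + 1) = b ∧ c j ≤ b ∧ Chain S r j c ∧
      ∀ k < j, ∀ n, c (k + 1) < n → n ≤ c (k + 2) → ¬ S k n := by
  induction j generalizing b with
  | zero =>
    refine ⟨fun k => if k = 0 then r else b, by simp, ?_, ⟨by simp, by omega⟩, by omega⟩
    simpa [← hd.1] using hb
  | succ j ih =>
    classical
    have hdj := hd.2 j (by omega)
    have hm := Nat.findGreatest_spec (P := S j) hb hdj.2
    have hle := Nat.le_findGreatest (P := S j) hb hdj.2
    have hmb := Nat.findGreatest_le (P := S j) b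
    have hgt : ∀ n, Nat.findGreatest (S j) b < n → n ≤ b → ¬ S j n :=
      fun n h1 h2 => Nat.findGreatest_is_greatest h1 h2
    generalize Nat.findGreatest (S j) b = m at hm hle hmb hgt
    obtain ⟨c, hc1, hc2, hc3, hc4⟩ := ih m (hd.mono (by omega)) (hdj.1.trans hle)
    have hu : ∀ i, i ≤ j + 1 → Function.update c (j + 2) b i = c i :=
      fun i hi => Function.update_of_ne (by omega) _ _
    refine ⟨Function.update c (j + 2) b, by simp, by rw [hu _ le_rfl, hc1]; exact hmb,
      ⟨by rw [hu _ (by omega)]; exact hc3.1, fun k hk => ?_⟩, fun k hk n => ?_⟩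
    · rw [hu _ (by omega), hu _ (by omega)]
      rcases Nat.lt_succ_iff_lt_or_eq.1 hk with hk | rfl
      · exact hc3.2 k hk
      · rw [hc1]; exact ⟨hc2, hm⟩
    · rw [hu _ (by omega)]
      rcases Nat.lt_succ_iff_lt_or_eq.1 hk with hk | rfl
      · rw [hu _ (by omega)]
        exact hc4 k hk n
      · rw [hc1, Function.update_self]
        exact hgt n

lemma Reach.exists_max {S : ℕ → ℕ → Prop} {r j b : ℕ} (h : Reach S r j)
    (hb : ∀ k n, S k n → n ≤ b) : ∃ c, MaxChain S r j c := by
  obtain ⟨d, hd⟩ := h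
  obtain ⟨c, hc1, -, hc3, hc4⟩ := exists_maxChain_le (max b (d j)) hd (le_max_right _ _)
  refine ⟨c, hc3, fun k hk n hn hlt hS => hc4 k hk n hn ?_ hS⟩
  rcases Nat.lt_or_ge (k + 1) j with h | h
  · exact hlt h
  · rw [show k + 2 = j + 1 by omega, hc1]
    exact (hb k n hS).trans (le_max_left _ _)

/-! ### Shapes -/

lemma _root_.IsPartition.antitone {p : ℕ → ℕ} (hp : IsPartition p) : Antitone p :=
  antitone_nat_of_succ_le hp.1

lemma _root_.IsPartition.exists_zero {p : ℕ → ℕ} (hp : IsPartition p) :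
    ∃ N, ∀ i, N ≤ i → p i = 0 := by
  obtain ⟨N, hN⟩ := hp.2
  exact ⟨N, fun i hi => Nat.le_zero.1 ((hp.antitone hi).trans hN.le)⟩

lemma tailsum_eq_sum {p : ℕ → ℕ} {N : ℕ} (hN : ∀ i, N ≤ i → p i = 0) (k : ℕ) :
    tailsum p k = ∑ t ∈ Finset.range N, p (t + k) := by
  refine finsum_eq_sum_of_support_subset _ fun t ht => ?_
  by_contra h
  simp only [Finset.coe_range, Set.mem_Iio, not_lt] at h
  exact ht (hN _ (by omega))

lemma tailsum_succ {p : ℕ → ℕ} (hp : IsPartition p) (k : ℕ) :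
    tailsum p k = p k + tailsum p (k + 1) := by
  obtain ⟨N, hN⟩ := hp.exists_zero
  rw [tailsum_eq_sum (N := N + 1) (fun i hi => hN i (by omega)), tailsum_eq_sum hN,
    Finset.sum_range_succ', zero_add, add_comm]
  congr 1
  exact Finset.sum_congr rfl fun t _ => by congr 1; omega

lemma tailsum_anti {p : ℕ → ℕ} (hp : IsPartition p) : Antitone (tailsum p) :=
  antitone_nat_of_succ_le fun k => by rw [tailsum_succ hp k]; omega

lemma tailsum_eq_zero {p : ℕ → ℕ} {k : ℕ} (h : ∀ i, k ≤ i → p i = 0) : tailsum p k = 0 := by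
  simp [tailsum, h]

/-- Remove one box from row `i`. -/
def dec (p : ℕ → ℕ) (i : ℕ) : ℕ → ℕ := Function.update p i (p i - 1)

lemma dec_apply (p : ℕ → ℕ) (i k : ℕ) : dec p i k = if k = i then p i - 1 else p k := by
  simp [dec, Function.update_apply]

lemma isPartition_dec {p : ℕ → ℕ} (hp : IsPartition p) {i : ℕ} (hi : p (i + 1) < p i) :
    IsPartition (dec p i) := by
  refine ⟨fun k => ?_, ?_⟩
  · have := hp.1 k
    simp only [dec_apply]
    split_ifs <;> subst_vars <;> omega
  · obtain ⟨N, hN⟩ := hp.2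
    refine ⟨N, ?_⟩
    simp only [dec_apply]
    split_ifs <;> subst_vars <;> omega

lemma tailsum_dec {p : ℕ → ℕ} (hp : IsPartition p) {i : ℕ} (hi : p (i + 1) < p i) (k : ℕ) :
    tailsum p k = tailsum (dec p i) k + if k ≤ i then 1 else 0 := by
  have hgt : ∀ k, i < k → tailsum p k = tailsum (dec p i) k := fun k hk => by
    refine finsum_congr fun t => ?_
    rw [dec_apply, if_neg (by omega)]
  split_ifs with hk
  · induction hk using Nat.decreasingInduction with
    | self =>
      rw [tailsum_succ hp, tailsum_succ (isPartition_dec hp hi), hgt (i + 1) (by omega), dec_apply,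
        if_pos rfl]
      omega
    | of_succ k hk ih =>
      rw [tailsum_succ hp, tailsum_succ (isPartition_dec hp hi), ih, dec_apply, if_neg (by omega)]
      omega
  · exact hgt k (by omega)

section RCshape

variable {B : ℕ} {p : ℕ → ℕ} {M : Multiset (ℕ × ℕ)} {X : ℕ → Multiset (ℕ × ℕ)}

lemma IsRC.vac_of_large (h : IsRC B p M X) (hp : IsPartition p) {n : ℕ} (hn : tailsum p 0 ≤ n)
    (k : ℕ) : vac X k n = (p k : ℤ) - p (k + 1) := by
  have hq : ∀ k, qsum (X k) n = tailsum p k := fun k => by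
    rw [qsum_eq_len, h.size]
    rw [h.size]
    exact (tailsum_anti hp (Nat.zero_le k)).trans hn
  have h1 := tailsum_succ hp k
  have h2 := tailsum_succ hp (k + 1)
  simp only [vac, hq]
  push_cast [h1, h2]
  ring

lemma IsRC.sing_le (h : IsRC B p M X) (hp : IsPartition p) {k n : ℕ} (hs : Sing X k n) :
    n ≤ tailsum p 0 := by
  obtain ⟨J, hJ, -⟩ := hs
  have := fst_le_len hJ
  rw [h.size] at this
  exact this.trans (tailsum_anti hp (Nat.zero_le _))

lemma IsRC.sing_zero (h : IsRC B p M X) {k : ℕ} (hB : tailsum p (k + 1) < B) : Sing X k 0 := by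
  have : ∃ x ∈ X (k + 1), x.1 = 0 := by
    by_contra! hne
    have hle : (X (k + 1)).card ≤ len (X (k + 1)) := by
      have := Multiset.card_nsmul_le_sum (s := (X (k + 1)).map Prod.fst) (a := 1) (by
        simp only [Multiset.mem_map]
        rintro _ ⟨x, hx, rfl⟩
        exact Nat.one_le_iff_ne_zero.2 (hne x hx))
      simpa [len] using this
    rw [h.card, h.size] at hle
    omega
  obtain ⟨⟨_, J⟩, hx, rfl⟩ := this
  have hr := h.rig k _ hx
  simp only [vac_zero] at hr
  exact ⟨J, hx, by rw [vac_zero]; omega⟩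

end RCshape

/-! ### The box removal relation -/

/-- `Y` arises from `X` by shortening, for every `k ≤ j`, a string of length `ℓ k` of level `k`,
which is singular both before and after for `k ≥ 1`. -/
structure Rel (j : ℕ) (ℓ : ℕ → ℕ) (X Y : ℕ → Multiset (ℕ × ℕ)) : Prop where
  pos : 1 ≤ ℓ 0
  mono : ∀ k < j, ℓ k ≤ ℓ (k + 1)
  head : ∃ Z, X 0 = (ℓ 0, 0) ::ₘ Z ∧ Y 0 = (ℓ 0 - 1, 0) ::ₘ Z
  swap : ∀ k < j, ∃ (a b : ℕ) (Z : Multiset (ℕ × ℕ)), X (k + 1) = (ℓ (k + 1), a) ::ₘ Z ∧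
    Y (k + 1) = (ℓ (k + 1) - 1, b) ::ₘ Z ∧ (a : ℤ) = vac X k (ℓ (k + 1)) ∧
    (b : ℤ) = vac Y k (ℓ (k + 1) - 1)
  tail : ∀ k > j, X k = Y k

/-- The change of `qsum` at level `k` under box removal. -/
def ind (j : ℕ) (ℓ : ℕ → ℕ) (k n : ℕ) : ℤ := if k ≤ j ∧ ℓ k ≤ n then 1 else 0

section Rel

variable {j : ℕ} {ℓ : ℕ → ℕ} {X Y : ℕ → Multiset (ℕ × ℕ)}

lemma Rel.pos' (h : Rel j ℓ X Y) {k : ℕ} (hk : k ≤ j) : 1 ≤ ℓ k := by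
  induction k with
  | zero => exact h.pos
  | succ k ih => exact (ih (by omega)).trans (h.mono k (by omega))

lemma Rel.exists_cons (h : Rel j ℓ X Y) {k : ℕ} (hk : k ≤ j) :
    ∃ (a b : ℕ) (Z : Multiset (ℕ × ℕ)), X k = (ℓ k, a) ::ₘ Z ∧ Y k = (ℓ k - 1, b) ::ₘ Z := by
  rcases k with _ | k
  · obtain ⟨Z, h1, h2⟩ := h.head
    exact ⟨0, 0, Z, h1, h2⟩
  · obtain ⟨a, b, Z, h1, h2, -⟩ := h.swap k (by omega)
    exact ⟨a, b, Z, h1, h2⟩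

lemma Rel.qsum (h : Rel j ℓ X Y) (k n : ℕ) : qsum (Y k) n = qsum (X k) n - ind j ℓ k n := by
  by_cases hk : k ≤ j
  · obtain ⟨a, b, Z, h1, h2⟩ := h.exists_cons hk
    have := h.pos' hk
    rw [h1, h2, qsum_cons, qsum_cons, ind]
    split_ifs <;> simp only [] <;> omega
  · rw [h.tail k (by omega), ind, if_neg (by omega), sub_zero]

lemma Rel.vac (h : Rel j ℓ X Y) (k n : ℕ) :
    vac Y k n = vac X k n - ind j ℓ k n + 2 * ind j ℓ (k + 1) n - ind j ℓ (k + 2) n := by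
  simp only [RiggedConfig.vac, h.qsum]
  ring

lemma Rel.vac_low (h : Rel j ℓ X Y) {k n : ℕ} (hk : k ≤ j) (hn : ℓ k ≤ n)
    (hlt : k < j → n < ℓ (k + 1)) : RiggedConfig.vac Y k n = RiggedConfig.vac X k n - 1 := by
  have : k + 1 < j → ℓ (k + 1) ≤ ℓ (k + 2) := h.mono (k + 1)
  rw [h.vac, ind, ind, ind, if_pos ⟨hk, hn⟩, if_neg (by omega), if_neg (by omega)]
  ring

lemma Rel.vac_high (h : Rel j ℓ X Y) {k n : ℕ} (hk : k < j) (hn : ℓ (k + 1) ≤ n)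
    (hlt : k + 1 < j → n < ℓ (k + 2)) : RiggedConfig.vac Y k n = RiggedConfig.vac X k n + 1 := by
  have := h.mono k hk
  rw [h.vac, ind, ind, ind, if_pos ⟨hk.le, by omega⟩, if_pos ⟨hk, hn⟩, if_neg (by omega)]
  ring

lemma Rel.vac_cases (h : Rel j ℓ X Y) (k n : ℕ) :
    (k ≤ j ∧ ℓ k ≤ n ∧ (k < j → n < ℓ (k + 1))) ∨
      (k < j ∧ ℓ (k + 1) ≤ n ∧ (k + 1 < j → n < ℓ (k + 2))) ∨
      RiggedConfig.vac Y k n = RiggedConfig.vac X k n := by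
  by_cases h1 : k ≤ j ∧ ℓ k ≤ n
  · by_cases h2 : k < j → n < ℓ (k + 1)
    · exact Or.inl ⟨h1.1, h1.2, h2⟩
    · push Not at h2
      by_cases h3 : k + 1 < j → n < ℓ (k + 2)
      · exact Or.inr (Or.inl ⟨h2.1, h2.2, h3⟩)
      · push Not at h3
        right; right
        rw [h.vac, ind, ind, ind, if_pos h1, if_pos ⟨h2.1, h2.2⟩, if_pos ⟨h3.1, h3.2⟩]
        ring
  · have m0 := h.mono k
    have m1 : k + 1 < j → ℓ (k + 1) ≤ ℓ (k + 2) := h.mono (k + 1)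
    right; right
    rw [h.vac, ind, ind, ind, if_neg h1, if_neg (by omega), if_neg (by omega)]
    ring

lemma Rel.right_unique (h : Rel j ℓ X Y) {ℓ' : ℕ → ℕ} {Y' : ℕ → Multiset (ℕ × ℕ)}
    (h' : Rel j ℓ' X Y') (hℓ : ∀ k ≤ j, ℓ k = ℓ' k) : Y = Y' := by
  have hi : ∀ k n, ind j ℓ k n = ind j ℓ' k n := fun k n => by
    by_cases hk : k ≤ j
    · simp only [ind, hℓ k hk]
    · simp [ind, hk]
  funext k
  rcases k with _ | k
  · obtain ⟨Z, h1, h2⟩ := h.head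
    obtain ⟨Z', h1', h2'⟩ := h'.head
    rw [h1, ← hℓ 0 (by omega), Multiset.cons_inj_right] at h1'
    rw [h2, h2', ← hℓ 0 (by omega), h1']
  · by_cases hk : k < j
    · obtain ⟨a, b, Z, h1, h2, h3, h4⟩ := h.swap k hk
      obtain ⟨a', b', Z', h1', h2', h3', h4'⟩ := h'.swap k hk
      rw [h.vac] at h4
      rw [h'.vac] at h4'
      simp only [← hi, ← hℓ (k + 1) hk] at h1' h2' h3' h4'
      obtain rfl : a = a' := by omega
      obtain rfl : b = b' := by omega
      rw [h1, Multiset.cons_inj_right] at h1'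
      rw [h2, h2', h1']
    · rw [← h.tail _ (by omega), ← h'.tail _ (by omega)]

lemma Rel.left_unique (h : Rel j ℓ X Y) {ℓ' : ℕ → ℕ} {X' : ℕ → Multiset (ℕ × ℕ)}
    (h' : Rel j ℓ' X' Y) (hℓ : ∀ k ≤ j, ℓ k = ℓ' k) : X = X' := by
  have hi : ∀ k n, ind j ℓ k n = ind j ℓ' k n := fun k n => by
    by_cases hk : k ≤ j
    · simp only [ind, hℓ k hk]
    · simp [ind, hk]
  have hv : ∀ k n, RiggedConfig.vac X k n = RiggedConfig.vac X' k n := fun k n => by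
    have h1 := h.vac k n
    have h2 := h'.vac k n
    simp only [← hi] at h2
    linarith
  funext k
  rcases k with _ | k
  · obtain ⟨Z, h1, h2⟩ := h.head
    obtain ⟨Z', h1', h2'⟩ := h'.head
    rw [h2, ← hℓ 0 (by omega), Multiset.cons_inj_right] at h2'
    rw [h1, h1', ← hℓ 0 (by omega), h2']
  · by_cases hk : k < j
    · obtain ⟨a, b, Z, h1, h2, h3, h4⟩ := h.swap k hk
      obtain ⟨a', b', Z', h1', h2', h3', h4'⟩ := h'.swap k hk
      simp only [← hv, ← hℓ (k + 1) hk] at h1' h2' h3' h4'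
      obtain rfl : a = a' := by omega
      obtain rfl : b = b' := by omega
      rw [h2, Multiset.cons_inj_right] at h2'
      rw [h1, h1', h2']
    · rw [h.tail _ (by omega), h'.tail _ (by omega)]

end Rel

section Forward

variable {B r j : ℕ} {p ℓ : ℕ → ℕ} {M : Multiset (ℕ × ℕ)} {X Y : ℕ → Multiset (ℕ × ℕ)}

lemma IsRC.vac_pos_of_minChain (h : IsRC B p ((r, 0) ::ₘ M) X) (hr : 1 ≤ r)
    (hc : MinChain (Sing X) r j ℓ) {k n : ℕ} (hk : k ≤ j) (hn : ℓ k ≤ n)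
    (hlt : k < j → n < ℓ (k + 1)) : 1 ≤ vac X k n := by
  have hpos : 0 < cnt (X k) (ℓ k) := by
    rcases k with _ | k
    · rw [hc.chain.1]
      exact cnt_pos_of_mem (x := (r, 0)) (by rw [h.base]; exact Multiset.mem_cons_self _ _)
    · obtain ⟨J, hJ, -⟩ := (hc.chain.2 k (by omega)).2
      exact cnt_pos_of_mem hJ
  induction n with
  | zero => have := hc.chain.le hk; omega
  | succ n ih =>
    by_contra hv
    have h0 := h.nonneg k (n + 1)
    obtain ⟨h1, -, h2, -⟩ := h.of_vac_eq_zero (hc.gap k hk _ hn hlt) (by omega)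
    rcases hn.eq_or_lt with heq | hn
    · rw [heq] at hpos
      omega
    · have := ih (by omega) (by omega)
      omega

lemma IsRC.exists_rel (h : IsRC B p ((r, 0) ::ₘ M) X) (hr : 1 ≤ r)
    (hc : MinChain (Sing X) r j ℓ) : ∃ Y, Rel j ℓ X Y ∧ Y 0 = (r - 1, 0) ::ₘ M := by
  have hle : ∀ k ≤ j, 1 ≤ ℓ k := fun k hk => hr.trans (hc.chain.le hk)
  have hex : ∀ k, ∃ (a : ℕ) (Z : Multiset (ℕ × ℕ)), k < j →
      X (k + 1) = (ℓ (k + 1), a) ::ₘ Z ∧ (a : ℤ) = vac X k (ℓ (k + 1)) := fun k => by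
    by_cases hk : k < j
    · obtain ⟨J, hJ, hv⟩ := (hc.chain.2 k hk).2
      obtain ⟨Z, hZ⟩ := Multiset.exists_cons_of_mem hJ
      exact ⟨J, Z, fun _ => ⟨hZ, hv⟩⟩
    · exact ⟨0, 0, fun hk' => absurd hk' hk⟩
  choose a Z haZ using hex
  let v : ℕ → ℕ → ℤ := fun k n =>
    vac X k n - ind j ℓ k n + 2 * ind j ℓ (k + 1) n - ind j ℓ (k + 2) n
  let Y : ℕ → Multiset (ℕ × ℕ) := fun k => match k with
    | 0 => (r - 1, 0) ::ₘ M
    | k + 1 => if k < j then (ℓ (k + 1) - 1, (v k (ℓ (k + 1) - 1)).toNat) ::ₘ Z k else X (k + 1)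
  have hYs : ∀ k, Y (k + 1) =
    if k < j then (ℓ (k + 1) - 1, (v k (ℓ (k + 1) - 1)).toNat) ::ₘ Z k else X (k + 1) :=
    fun k => rfl
  have hq : ∀ k n, qsum (Y k) n = qsum (X k) n - ind j ℓ k n := fun k n => by
    rcases k with _ | k
    · rw [h.base, show Y 0 = (r - 1, 0) ::ₘ M from rfl, qsum_cons, qsum_cons, ind, hc.chain.1]
      split_ifs <;> simp only [] <;> omega
    · rw [hYs]
      by_cases hk : k < j
      · have := hle (k + 1) hk
        rw [if_pos hk, (haZ k hk).1, qsum_cons, qsum_cons, ind]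
        split_ifs <;> simp only [] <;> omega
      · rw [if_neg hk, ind, if_neg (by omega), sub_zero]
  have hv : ∀ k n, vac Y k n = v k n := fun k n => by
    simp only [vac, hq, v]
    ring
  refine ⟨Y, ⟨by rw [hc.chain.1]; exact hr, fun k hk => (hc.chain.2 k hk).1,
    ⟨M, by rw [h.base, hc.chain.1], by rw [hc.chain.1]⟩, fun k hk =>
    ⟨a k, (v k (ℓ (k + 1) - 1)).toNat, Z k, (haZ k hk).1, by rw [hYs, if_pos hk], (haZ k hk).2, ?_⟩,
    fun k hk => ?_⟩, rfl⟩
  · have h1 := hle (k + 1) hk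
    have h2 : k + 1 < j → ℓ (k + 1) ≤ ℓ (k + 2) := fun h => (hc.chain.2 (k + 1) h).1
    have h3 := h.nonneg k (ℓ (k + 1) - 1)
    rw [hv, Int.toNat_of_nonneg]
    simp only [v, ind]
    rw [if_neg (c := k + 1 ≤ j ∧ _) (by omega), if_neg (c := k + 2 ≤ j ∧ _) (by omega)]
    split_ifs with h4
    · have := h.vac_pos_of_minChain hr hc h4.1 h4.2 (by omega)
      omega
    · omega
  · obtain ⟨k, rfl⟩ : ∃ i, k = i + 1 := ⟨k - 1, by omega⟩
    rw [hYs, if_neg (by omega)]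

lemma IsRC.lt_of_minChain (h : IsRC B p ((r, 0) ::ₘ M) X) (hp : IsPartition p) (hr : 1 ≤ r)
    (hc : MinChain (Sing X) r j ℓ) : p (j + 1) < p j := by
  have h1 := h.vac_pos_of_minChain hr hc le_rfl (n := ℓ j + tailsum p 0) (by omega) (by omega)
  rw [h.vac_of_large hp (by omega)] at h1
  omega

lemma Rel.card_eq (hR : Rel j ℓ X Y) (k : ℕ) : (X k).card = (Y k).card := by
  by_cases hk : k ≤ j
  · obtain ⟨a, b, Z, h1, h2⟩ := hR.exists_cons hk
    rw [h1, h2, Multiset.card_cons, Multiset.card_cons]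
  · rw [hR.tail k (by omega)]

lemma Rel.len_eq (hR : Rel j ℓ X Y) (k : ℕ) : len (X k) = len (Y k) + if k ≤ j then 1 else 0 := by
  split_ifs with hk
  · obtain ⟨a, b, Z, h1, h2⟩ := hR.exists_cons hk
    have := hR.pos' hk
    rw [h1, h2, len_cons, len_cons]
    simp only
    omega
  · rw [hR.tail k (by omega), add_zero]

lemma Rel.isRC_right (hR : Rel j ℓ X Y) (h : IsRC B p ((r, 0) ::ₘ M) X) (hp : IsPartition p)
    (hr : 1 ≤ r) (hc : MinChain (Sing X) r j ℓ) (hY : Y 0 = (r - 1, 0) ::ₘ M) :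
    IsRC B (dec p j) ((r - 1, 0) ::ₘ M) Y := by
  have hpos := fun {k n} => h.vac_pos_of_minChain (k := k) (n := n) hr hc
  refine ⟨hY, fun k => by rw [← hR.card_eq, h.card], fun k => ?_, fun k n => ?_, fun k x hx => ?_⟩
  · have h1 := hR.len_eq k
    have h2 := tailsum_dec hp (h.lt_of_minChain hp hr hc) k
    rw [h.size] at h1
    omega
  · have h0 := h.nonneg k n
    rcases hR.vac_cases k n with ⟨h1, h2, h3⟩ | ⟨h1, h2, h3⟩ | h1
    · rw [hR.vac_low h1 h2 h3]
      have := hpos h1 h2 h3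
      omega
    · rw [hR.vac_high h1 h2 h3]
      omega
    · omega
  · have hold : x ∈ X (k + 1) → (x.2 : ℤ) ≤ RiggedConfig.vac Y k x.1 := fun hx => by
      have h0 := h.rig k x hx
      rcases hR.vac_cases k x.1 with ⟨h1, h2, h3⟩ | ⟨h1, h2, h3⟩ | h1
      · rw [hR.vac_low h1 h2 h3]
        have : (x.2 : ℤ) ≠ RiggedConfig.vac X k x.1 := fun he => hc.gap k h1 _ h2 h3 ⟨x.2, hx, he⟩
        omega
      · rw [hR.vac_high h1 h2 h3]
        omega
      · omega
    by_cases hk : k < j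
    · obtain ⟨a, b, Z, h1, h2, h3, h4⟩ := hR.swap k hk
      rw [h2, Multiset.mem_cons] at hx
      rcases hx with rfl | hx
      · exact h4.le
      · exact hold (by rw [h1]; exact Multiset.mem_cons_of_mem hx)
    · exact hold (by rw [hR.tail _ (by omega)]; exact hx)

lemma Rel.maxChain (hR : Rel j ℓ X Y) (h : IsRC B p ((r, 0) ::ₘ M) X)
    (hc : MinChain (Sing X) r j ℓ) : MaxChain (Sing Y) (r - 1) j (fun k => ℓ k - 1) := by
  refine ⟨⟨by simp only [hc.chain.1], fun k hk => ⟨Nat.sub_le_sub_right (hR.mono k hk) 1, ?_⟩⟩,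
    fun k hk n hn hlt => ?_⟩
  · obtain ⟨a, b, Z, h1, h2, h3, h4⟩ := hR.swap k hk
    exact ⟨b, by rw [h2]; exact Multiset.mem_cons_self _ _, h4⟩
  · have hp := hR.pos' (k := k + 1) hk
    have hp' : k + 1 < j → 1 ≤ ℓ (k + 2) := fun h => hR.pos' h
    rintro ⟨J, hJ, hv⟩
    obtain ⟨a, b, Z, h1, h2, h3, h4⟩ := hR.swap k hk
    rw [h2, Multiset.mem_cons, Prod.mk.injEq] at hJ
    have := h.rig k (n, J) (by rw [h1]; exact Multiset.mem_cons_of_mem (hJ.resolve_left (by omega)))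
    rw [hR.vac_high hk (by omega) (by omega)] at hv
    simp only at this
    omega

end Forward

section Backward

variable {B r j : ℕ} {p ℓ : ℕ → ℕ} {M : Multiset (ℕ × ℕ)} {X Y : ℕ → Multiset (ℕ × ℕ)}

lemma IsRC.vac_pos_of_maxChain (h : IsRC B (dec p j) ((r - 1, 0) ::ₘ M) Y) (hp : IsPartition p)
    (hj : p (j + 1) < p j) (hℓ : ∀ k ≤ j, 1 ≤ ℓ k)
    (hc : MaxChain (Sing Y) (r - 1) j (fun k => ℓ k - 1)) {k n : ℕ} (hk : k < j)
    (hn : ℓ (k + 1) ≤ n) (hlt : k + 1 < j → n < ℓ (k + 2)) : 1 ≤ vac Y k n := by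
  have hgap : ∀ n, ℓ (k + 1) ≤ n → (k + 1 < j → n < ℓ (k + 2)) → ¬ Sing Y k n :=
    fun n h1 h2 => hc.gap k hk n (by have := hℓ (k + 1) hk; omega)
      (fun h3 => by have := h2 h3; omega)
  have hℓ1 := hℓ (k + 1) hk
  have hp' := isPartition_dec hp hj
  have hlarge : k + 1 = j → ∀ n, tailsum (dec p j) 0 ≤ n → 1 ≤ vac Y k n := fun hkj n hn => by
    have := hp.1 k
    rw [h.vac_of_large hp' hn, dec_apply, dec_apply, if_neg (by omega), if_pos hkj]
    subst hkj
    omega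
  have hend : ∃ N, n ≤ N ∧ (k + 1 < j → N < ℓ (k + 2)) ∧ 1 ≤ vac Y k N := by
    by_cases hkj : k + 1 < j
    · have hlt := hlt hkj
      refine ⟨ℓ (k + 2) - 1, by omega, by omega, ?_⟩
      by_contra hv
      have h0 := h.nonneg k (ℓ (k + 2) - 1)
      obtain ⟨m, hm⟩ : ∃ m, ℓ (k + 2) - 1 = m + 1 := ⟨ℓ (k + 2) - 2, by omega⟩
      obtain ⟨J, hJ, -⟩ := (hc.chain.2 (k + 1) hkj).2
      have hcnt := cnt_pos_of_mem hJ
      have hg := hgap (ℓ (k + 2) - 1) (by omega) (by omega)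
      simp only [add_assoc, Nat.reduceAdd] at hcnt
      rw [hm] at hg hv h0 hcnt
      have := (h.of_vac_eq_zero hg (by omega)).2.2.2
      omega
    · exact ⟨n + tailsum (dec p j) 0, by omega, by omega, hlarge (by omega) _ (by omega)⟩
  obtain ⟨N, hN, hNlt, hNv⟩ := hend
  induction hN using Nat.decreasingInduction with
  | self => exact hNv
  | of_succ n hnN ih =>
    have ih := ih (by omega) (by omega)
    by_contra hv
    have h0 := h.nonneg k n
    obtain ⟨m, rfl⟩ : ∃ m, n = m + 1 := ⟨n - 1, by omega⟩
    have := (h.of_vac_eq_zero (hgap (m + 1) hn hlt) (by omega)).2.1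
    have e : m + 1 + 1 = m + 2 := rfl
    rw [e] at ih
    omega

lemma IsRC.exists_rel_left (h : IsRC B (dec p j) ((r - 1, 0) ::ₘ M) Y) (hp : IsPartition p)
    (hj : p (j + 1) < p j) (hr : 1 ≤ r) (hℓ : ∀ k ≤ j, 1 ≤ ℓ k)
    (hc : MaxChain (Sing Y) (r - 1) j (fun k => ℓ k - 1)) :
    ∃ X, Rel j ℓ X Y ∧ X 0 = (r, 0) ::ₘ M := by
  have hℓ0 : ℓ 0 = r := by have := hc.chain.1; have := hℓ 0 (by omega); simp only at *; omega
  have hmono : ∀ k < j, ℓ k ≤ ℓ (k + 1) := fun k hk => by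
    have := (hc.chain.2 k hk).1
    have := hℓ k (by omega)
    have := hℓ (k + 1) (by omega)
    simp only at *
    omega
  have hex : ∀ k, ∃ (b : ℕ) (Z : Multiset (ℕ × ℕ)), k < j →
      Y (k + 1) = (ℓ (k + 1) - 1, b) ::ₘ Z ∧ (b : ℤ) = vac Y k (ℓ (k + 1) - 1) := fun k => by
    by_cases hk : k < j
    · obtain ⟨J, hJ, hv⟩ := (hc.chain.2 k hk).2
      obtain ⟨Z, hZ⟩ := Multiset.exists_cons_of_mem hJ
      exact ⟨J, Z, fun _ => ⟨hZ, hv⟩⟩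
    · exact ⟨0, 0, fun hk' => absurd hk' hk⟩
  choose b Z hbZ using hex
  let v : ℕ → ℕ → ℤ := fun k n =>
    vac Y k n + ind j ℓ k n - 2 * ind j ℓ (k + 1) n + ind j ℓ (k + 2) n
  let X : ℕ → Multiset (ℕ × ℕ) := fun k => match k with
    | 0 => (r, 0) ::ₘ M
    | k + 1 => if k < j then (ℓ (k + 1), (v k (ℓ (k + 1))).toNat) ::ₘ Z k else Y (k + 1)
  have hXs : ∀ k, X (k + 1) =
    if k < j then (ℓ (k + 1), (v k (ℓ (k + 1))).toNat) ::ₘ Z k else Y (k + 1) := fun k => rfl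
  have hq : ∀ k n, qsum (X k) n = qsum (Y k) n + ind j ℓ k n := fun k n => by
    rcases k with _ | k
    · rw [h.base, show X 0 = (r, 0) ::ₘ M from rfl, qsum_cons, qsum_cons, ind, hℓ0]
      split_ifs <;> simp only [] <;> omega
    · rw [hXs]
      by_cases hk : k < j
      · have := hℓ (k + 1) hk
        rw [if_pos hk, (hbZ k hk).1, qsum_cons, qsum_cons, ind]
        split_ifs <;> simp only [] <;> omega
      · rw [if_neg hk, ind, if_neg (by omega), add_zero]
  have hv : ∀ k n, vac X k n = v k n := fun k n => by
    simp only [vac, hq, v]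
    ring
  refine ⟨X, ⟨by omega, hmono, ⟨M, by rw [hℓ0], by rw [h.base, hℓ0]⟩, fun k hk =>
    ⟨(v k (ℓ (k + 1))).toNat, b k, Z k, by rw [hXs, if_pos hk], (hbZ k hk).1, ?_, (hbZ k hk).2⟩,
    fun k hk => ?_⟩, rfl⟩
  · have h1 := hmono k hk
    have h3 := h.nonneg k (ℓ (k + 1))
    rw [hv, Int.toNat_of_nonneg]
    simp only [v, ind]
    rw [if_pos (c := k ≤ j ∧ _) (by omega), if_pos (c := k + 1 ≤ j ∧ _) (by omega)]
    split_ifs with h4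
    · omega
    · have := h.vac_pos_of_maxChain hp hj hℓ hc hk le_rfl (by omega)
      omega
  · obtain ⟨k, rfl⟩ : ∃ i, k = i + 1 := ⟨k - 1, by omega⟩
    rw [hXs, if_neg (by omega)]

lemma Rel.isRC_left (hR : Rel j ℓ X Y) (h : IsRC B (dec p j) ((r - 1, 0) ::ₘ M) Y)
    (hp : IsPartition p) (hj : p (j + 1) < p j)
    (hc : MaxChain (Sing Y) (r - 1) j (fun k => ℓ k - 1)) (hX : X 0 = (r, 0) ::ₘ M) :
    IsRC B p ((r, 0) ::ₘ M) X := by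
  have hgap : ∀ k < j, ∀ n, ℓ (k + 1) ≤ n → (k + 1 < j → n < ℓ (k + 2)) → ¬ Sing Y k n :=
    fun k hk n h1 h2 => hc.gap k hk n (by have := hR.pos' (k := k + 1) hk; omega)
      (fun h3 => by have := h2 h3; omega)
  refine ⟨hX, fun k => by rw [hR.card_eq, h.card], fun k => ?_, fun k n => ?_, fun k x hx => ?_⟩
  · have h1 := hR.len_eq k
    have h2 := tailsum_dec hp hj k
    rw [h.size] at h1
    omega
  · have h0 := h.nonneg k n
    rcases hR.vac_cases k n with ⟨h1, h2, h3⟩ | ⟨h1, h2, h3⟩ | h1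
    · have := hR.vac_low h1 h2 h3
      omega
    · have := hR.vac_high h1 h2 h3
      have := h.vac_pos_of_maxChain hp hj (fun k hk => hR.pos' hk) hc h1 h2 h3
      omega
    · omega
  · have hold : x ∈ Y (k + 1) → (x.2 : ℤ) ≤ RiggedConfig.vac X k x.1 := fun hx => by
      have h0 := h.rig k x hx
      rcases hR.vac_cases k x.1 with ⟨h1, h2, h3⟩ | ⟨h1, h2, h3⟩ | h1
      · have := hR.vac_low h1 h2 h3
        omega
      · have := hR.vac_high h1 h2 h3
        have : (x.2 : ℤ) ≠ RiggedConfig.vac Y k x.1 := fun he => hgap k h1 _ h2 h3 ⟨x.2, hx, he⟩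
        omega
      · omega
    by_cases hk : k < j
    · obtain ⟨a, b, Z, h1, h2, h3, h4⟩ := hR.swap k hk
      rw [h1, Multiset.mem_cons] at hx
      rcases hx with rfl | hx
      · exact h3.le
      · exact hold (by rw [h2]; exact Multiset.mem_cons_of_mem hx)
    · exact hold (by rw [← hR.tail _ (by omega)]; exact hx)

lemma Rel.minChain (hR : Rel j ℓ X Y) (h : IsRC B (dec p j) ((r - 1, 0) ::ₘ M) Y) (hr : 1 ≤ r)
    (hc : MaxChain (Sing Y) (r - 1) j (fun k => ℓ k - 1)) : MinChain (Sing X) r j ℓ := by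
  have hℓ0 : ℓ 0 = r := by have := hc.chain.1; have := hR.pos; simp only at *; omega
  refine ⟨⟨hℓ0, fun k hk => ⟨hR.mono k hk, ?_⟩⟩, fun k hk n hn hlt => ?_⟩
  · obtain ⟨a, b, Z, h1, h2, h3, h4⟩ := hR.swap k hk
    exact ⟨a, by rw [h1]; exact Multiset.mem_cons_self _ _, h3⟩
  · rintro ⟨J, hJ, hv⟩
    have hv' := hR.vac_low hk hn hlt
    have : (n, J) ∈ Y (k + 1) := by
      by_cases hkj : k < j
      · obtain ⟨a, b, Z, h1, h2, h3, h4⟩ := hR.swap k hkj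
        have := hlt hkj
        rw [h1, Multiset.mem_cons, Prod.mk.injEq] at hJ
        rw [h2]
        exact Multiset.mem_cons_of_mem (hJ.resolve_left (by omega))
      · rwa [← hR.tail _ (by omega)]
    have := h.rig k _ this
    simp only at this
    omega

end Backward

lemma nonempty_equiv_of_rel {α β : Type*} (R : α → β → Prop) (h1 : ∀ a, ∃ b, R a b)
    (h2 : ∀ b, ∃ a, R a b) (h3 : ∀ a b b', R a b → R a b' → b = b')
    (h4 : ∀ a a' b, R a b → R a' b → a = a') : Nonempty (α ≃ β) := by
  choose f hf using h1
  choose g hg using h2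
  exact ⟨⟨f, g, fun a => h4 _ _ _ (hg _) (hf _), fun b => h3 _ _ _ (hf _) (hg _)⟩⟩

/-- Removing one box from a row of length `r` of level zero removes a box from a row `i` of the
shape; iterating, the rows are weakly increasing. -/
theorem nonempty_rc_equiv {B r : ℕ} {p : ℕ → ℕ} (hp : IsPartition p) (hr : 1 ≤ r)
    (M : Multiset (ℕ × ℕ)) (j : ℕ) :
    Nonempty ({X // IsRC B p ((r, 0) ::ₘ M) X ∧ Reach (Sing X) r j} ≃
      Σ i : {i // j ≤ i ∧ p (i + 1) < p i},
        {Y // IsRC B (dec p i) ((r - 1, 0) ::ₘ M) Y ∧ Reach (Sing Y) (r - 1) i}) := by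
  refine nonempty_equiv_of_rel (fun X Z => ∃ ℓ, Rel Z.1 ℓ X.1 Z.2.1 ∧
    MinChain (Sing X.1) r Z.1 ℓ ∧ MaxChain (Sing Z.2.1) (r - 1) Z.1 (fun k => ℓ k - 1)) ?_ ?_ ?_ ?_
  · rintro ⟨X, hX, hreach⟩
    have hex : ∃ i, ¬ Reach (Sing X) r (i + 1) := by
      obtain ⟨N, hN⟩ := hp.exists_zero
      refine ⟨N, fun ⟨c, hc⟩ => ?_⟩
      have h1 := hc.le (k := N + 1) le_rfl
      obtain ⟨J, hJ, -⟩ := (hc.2 N (by omega)).2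
      have h2 := fst_le_len hJ
      rw [hX.size, tailsum_eq_zero fun i hi => hN i (by omega)] at h2
      simp only at h2
      omega
    have hs := Nat.sInf_mem (s := {i | ¬ Reach (Sing X) r (i + 1)}) hex
    have hlt : ∀ i, i < sInf {i | ¬ Reach (Sing X) r (i + 1)} → Reach (Sing X) r (i + 1) :=
      fun i hi => not_not.1 (Nat.notMem_of_lt_sInf hi)
    generalize sInf {i | ¬ Reach (Sing X) r (i + 1)} = i at hs hlt
    have hji : j ≤ i := by
      by_contra h
      exact hs (hreach.mono (by omega))
    have hi : Reach (Sing X) r i := by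
      rcases i with _ | i
      · exact hreach.mono (Nat.zero_le _)
      · exact hlt i (by omega)
    obtain ⟨ℓ, hℓ⟩ := Chain.exists_min hi hs
    obtain ⟨Y, hR, hY⟩ := hX.exists_rel hr hℓ
    have hmax := hR.maxChain hX hℓ
    exact ⟨⟨⟨i, hji, hX.lt_of_minChain hp hr hℓ⟩, Y, hR.isRC_right hX hp hr hℓ hY, _, hmax.chain⟩,
      ℓ, hR, hℓ, hmax⟩
  · rintro ⟨⟨i, hji, hi⟩, Y, hY, hreach⟩
    obtain ⟨c, hc⟩ := hreach.exists_max fun k n => hY.sing_le (isPartition_dec hp hi)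
    obtain ⟨ℓ, rfl, hℓ⟩ : ∃ ℓ : ℕ → ℕ, c = (fun k => ℓ k - 1) ∧ ∀ k, 1 ≤ ℓ k :=
      ⟨fun k => c k + 1, rfl, fun k => Nat.succ_pos (c k)⟩
    obtain ⟨X, hR, hX⟩ := hY.exists_rel_left hp hi hr (fun k _ => hℓ k) hc
    have hmin := hR.minChain hY hr hc
    exact ⟨⟨X, hR.isRC_left hY hp hi hc hX, _, hmin.chain.mono hji⟩, ℓ, hR, hmin, hc⟩
  · rintro ⟨X, hX⟩ ⟨⟨i, hi⟩, Y, hY⟩ ⟨⟨i', hi'⟩, Y', hY'⟩ ⟨ℓ, hR, hmin, -⟩ ⟨ℓ', hR', hmin', -⟩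
    simp only at hR hR' hmin hmin'
    obtain rfl := hmin.rank_unique hmin'
    obtain rfl := hR.right_unique hR' fun k hk => hmin.unique hmin' hk
    rfl
  · rintro ⟨X, hX⟩ ⟨X', hX'⟩ ⟨⟨i, hi⟩, Y, hY⟩ ⟨ℓ, hR, -, hmax⟩ ⟨ℓ', hR', -, hmax'⟩
    simp only at hR hR' hmax hmax'
    refine Subtype.ext (hR.left_unique hR' fun k hk => ?_)
    have := hmax.unique hmax' hk
    have := hR.pos' hk
    have := hR'.pos' hk
    simp only at *
    omega

/-- The function `e` is a semistandard tableau of shape `p` and content `μ`. -/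
structure IsSSYT (p μ : ℕ → ℕ) (e : ℕ → ℕ → ℕ) : Prop where
  pos : ∀ r c, c < p r → 1 ≤ e r c
  row_weak : ∀ r c₁ c₂, c₁ ≤ c₂ → c₂ < p r → e r c₁ ≤ e r c₂
  col_strict : ∀ r₁ r₂ c, r₁ < r₂ → c < p r₂ → e r₁ c < e r₂ c
  zero_outside : ∀ r c, p r ≤ c → e r c = 0
  content : ∀ i : ℕ, Nat.card {x : ℕ × ℕ | x.2 < p x.1 ∧ e x.1 x.2 = i + 1} = μ i

lemma finite_boxes {p : ℕ → ℕ} (hp : IsPartition p) : {x : ℕ × ℕ | x.2 < p x.1}.Finite := by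
  obtain ⟨N, hN⟩ := hp.exists_zero
  refine ((Finset.range N ×ˢ Finset.range (p 0)).finite_toSet).subset fun x hx => ?_
  have hx' : x.2 < p x.1 := hx
  have h1 := hp.antitone (Nat.zero_le x.1)
  have h2 : x.1 < N := by
    by_contra! h
    rw [hN _ h] at hx'
    omega
  simp only [Finset.coe_product, Finset.coe_range, Set.mem_prod, Set.mem_Iio]
  omega

section Tableau

variable {p μ : ℕ → ℕ} {e : ℕ → ℕ → ℕ} {L i : ℕ}

lemma IsSSYT.lt_of_pos (h : IsSSYT p μ e) {r c : ℕ} (hpos : 1 ≤ e r c) : c < p r := by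
  by_contra! hc
  rw [h.zero_outside r c hc] at hpos
  omega

lemma IsSSYT.content_pos (h : IsSSYT p μ e) (hp : IsPartition p) {r c m : ℕ}
    (he : e r c = m + 1) : 1 ≤ μ m := by
  have hfin : {x : ℕ × ℕ | x.2 < p x.1 ∧ e x.1 x.2 = m + 1}.Finite :=
    (finite_boxes hp).subset fun x hx => hx.1
  rw [← h.content m, Nat.card_coe_set_eq, Nat.one_le_iff_ne_zero, ← Nat.pos_iff_ne_zero,
    Set.ncard_pos hfin]
  exact ⟨(r, c), h.lt_of_pos (he ▸ Nat.le_add_left 1 m), he⟩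

lemma IsSSYT.le (h : IsSSYT p μ e) (hp : IsPartition p) (hμ : ∀ i, L < i → μ i = 0) (r c : ℕ) :
    e r c ≤ L + 1 := by
  by_contra! hlt
  have := h.content_pos hp (r := r) (c := c) (m := e r c - 1) (by omega)
  rw [hμ _ (by omega)] at this
  omega

/-- Removing the last box of row `i`, filled with `L + 1`, from `e` gives `e'`. -/
structure Removes (p : ℕ → ℕ) (L i : ℕ) (e e' : ℕ → ℕ → ℕ) : Prop where
  last : e i (p i - 1) = L + 1
  rows : ∀ r c, e r c = L + 1 → i ≤ r
  zero : e' i (p i - 1) = 0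
  eq : ∀ r c, ¬ (r = i ∧ c = p i - 1) → e r c = e' r c

variable {e' : ℕ → ℕ → ℕ}

lemma Removes.rows' (h : Removes p L i e e') (r c : ℕ) (he : e' r c = L + 1) : i ≤ r := by
  by_cases hrc : r = i ∧ c = p i - 1
  · exact hrc.1.ge
  · exact h.rows r c ((h.eq r c hrc).trans he)

lemma Removes.card (h : Removes p L i e e') (hp : IsPartition p) (hi : p (i + 1) < p i) (m : ℕ) :
    Nat.card {x : ℕ × ℕ | x.2 < p x.1 ∧ e x.1 x.2 = m + 1} =
      Nat.card {x : ℕ × ℕ | x.2 < dec p i x.1 ∧ e' x.1 x.2 = m + 1} + if m = L then 1 else 0 := by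
  have hmem : ∀ x : ℕ × ℕ, x ≠ (i, p i - 1) → (x.2 < p x.1 ∧ e x.1 x.2 = m + 1 ↔
      x.2 < dec p i x.1 ∧ e' x.1 x.2 = m + 1) := fun ⟨r, c⟩ hx => by
    have hrc : ¬ (r = i ∧ c = p i - 1) := by simpa using hx
    simp only [h.eq r c hrc, dec_apply]
    refine and_congr_left fun _ => ?_
    split_ifs with hr
    · subst hr
      omega
    · rfl
  have hfin : {x : ℕ × ℕ | x.2 < dec p i x.1 ∧ e' x.1 x.2 = m + 1}.Finite :=
    (finite_boxes (isPartition_dec hp hi)).subset fun x hx => hx.1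
  have hnot : (i, p i - 1) ∉ {x : ℕ × ℕ | x.2 < dec p i x.1 ∧ e' x.1 x.2 = m + 1} := by
    simp [dec_apply]
  rw [Nat.card_coe_set_eq, Nat.card_coe_set_eq]
  split_ifs with hm
  · rw [← Set.ncard_insert_of_notMem hnot hfin]
    congr 1
    ext x
    by_cases hx : x = (i, p i - 1)
    · subst hx hm
      simp only [Set.mem_ofPred_eq, Set.mem_insert_iff, true_or, iff_true, h.last, and_true]
      omega
    · simp only [Set.mem_insert_iff, hx, false_or]
      exact hmem x hx
  · rw [add_zero]
    congr 1
    ext x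
    by_cases hx : x = (i, p i - 1)
    · subst hx
      refine iff_of_false (fun hx => ?_) hnot
      have := h.last
      have := hx.2
      simp only at this
      omega
    · exact hmem x hx

lemma dec_add (hL : 1 ≤ μ L) (m : ℕ) : μ m = dec μ L m + if m = L then 1 else 0 := by
  rw [dec_apply]
  split_ifs with h
  · subst h
    omega
  · rfl

lemma Removes.isSSYT_right (h : Removes p L i e e') (he : IsSSYT p μ e) (hp : IsPartition p)
    (hi : p (i + 1) < p i) (hL : 1 ≤ μ L) : IsSSYT (dec p i) (dec μ L) e' := by
  have hlt : ∀ r c, c < dec p i r → c < p r ∧ ¬ (r = i ∧ c = p i - 1) := fun r c hc => by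
    rw [dec_apply] at hc
    split_ifs at hc with hr
    · subst hr
      omega
    · exact ⟨hc, fun h => hr h.1⟩
  refine ⟨fun r c hc => ?_, fun r c₁ c₂ hle hc => ?_, fun r₁ r₂ c hr hc => ?_, fun r c hc => ?_,
    fun m => ?_⟩
  · obtain ⟨h1, h2⟩ := hlt r c hc
    rw [← h.eq r c h2]
    exact he.pos r c h1
  · obtain ⟨h1, h2⟩ := hlt r c₂ hc
    obtain ⟨h3, h4⟩ := hlt r c₁ (by omega)
    rw [← h.eq _ _ h2, ← h.eq _ _ h4]
    exact he.row_weak r c₁ c₂ hle h1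
  · obtain ⟨h1, h2⟩ := hlt r₂ c hc
    rw [← h.eq _ _ h2, ← h.eq r₁ c]
    · exact he.col_strict r₁ r₂ c hr h1
    · rintro ⟨rfl, rfl⟩
      have := hp.antitone (show r₁ + 1 ≤ r₂ by omega)
      omega
  · by_cases hrc : r = i ∧ c = p i - 1
    · rw [hrc.1, hrc.2, h.zero]
    · rw [← h.eq r c hrc]
      refine he.zero_outside r c ?_
      rw [dec_apply] at hc
      split_ifs at hc with hr
      · subst hr
        omega
      · exact hc
  · have h1 := h.card hp hi m
    rw [he.content, dec_add hL m] at h1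
    exact (Nat.add_right_cancel h1).symm

lemma Removes.isSSYT_left (h : Removes p L i e e') (he : IsSSYT (dec p i) (dec μ L) e')
    (hp : IsPartition p) (hi : p (i + 1) < p i) (hL : 1 ≤ μ L) (hμ : ∀ i, L < i → μ i = 0) :
    IsSSYT p μ e := by
  have hlt : ∀ r c, c < p r → ¬ (r = i ∧ c = p i - 1) → c < dec p i r := fun r c hc hrc => by
    rw [dec_apply]
    split_ifs with hr
    · subst hr
      omega
    · exact hc
  have hle : ∀ r c, e r c ≤ L + 1 := fun r c => by
    by_cases hrc : r = i ∧ c = p i - 1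
    · rw [hrc.1, hrc.2, h.last]
    · rw [h.eq r c hrc]
      refine he.le (isPartition_dec hp hi) (fun m hm => ?_) r c
      rw [dec_apply, if_neg (by omega), hμ m hm]
  refine ⟨fun r c hc => ?_, fun r c₁ c₂ hc12 hc => ?_, fun r₁ r₂ c hr hc => ?_, fun r c hc => ?_,
    fun m => ?_⟩
  · by_cases hrc : r = i ∧ c = p i - 1
    · rw [hrc.1, hrc.2, h.last]
      omega
    · rw [h.eq r c hrc]
      exact he.pos r c (hlt r c hc hrc)
  · by_cases hrc : r = i ∧ c₂ = p i - 1
    · rw [hrc.1, hrc.2, h.last]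
      exact hle _ _
    · have hrc' : ¬ (r = i ∧ c₁ = p i - 1) := by
        rintro ⟨rfl, rfl⟩
        omega
      rw [h.eq _ _ hrc, h.eq _ _ hrc']
      exact he.row_weak r c₁ c₂ hc12 (hlt r c₂ hc hrc)
  · by_cases hrc : r₂ = i ∧ c = p i - 1
    · rw [hrc.1, hrc.2, h.last]
      refine lt_of_le_of_ne (hle _ _) fun heq => ?_
      have := h.rows _ _ heq
      omega
    · have hrc' : ¬ (r₁ = i ∧ c = p i - 1) := by
        rintro ⟨rfl, rfl⟩
        have := hp.antitone (show r₁ + 1 ≤ r₂ by omega)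
        omega
      rw [h.eq _ _ hrc, h.eq _ _ hrc']
      exact he.col_strict r₁ r₂ c hr (hlt _ _ hc hrc)
  · rw [h.eq r c (by rintro ⟨rfl, rfl⟩; omega)]
    refine he.zero_outside r c ?_
    rw [dec_apply]
    split_ifs with hr
    · subst hr
      omega
    · exact hc
  · rw [h.card hp hi m, he.content, ← dec_add hL m]

lemma IsSSYT.exists_removes (h : IsSSYT p μ e) (hp : IsPartition p) (hL : 1 ≤ μ L)
    (hμ : ∀ i, L < i → μ i = 0) : ∃ i e', p (i + 1) < p i ∧ Removes p L i e e' := by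
  have hex : ∃ r c, e r c = L + 1 := by
    rw [← h.content L, Nat.card_coe_set_eq, Nat.one_le_iff_ne_zero] at hL
    obtain ⟨x, hx⟩ := Set.nonempty_of_ncard_ne_zero hL
    exact ⟨x.1, x.2, hx.2⟩
  classical
  obtain ⟨c, hc⟩ := Nat.find_spec hex
  have hmin : ∀ r c, e r c = L + 1 → Nat.find hex ≤ r := fun r c hrc => Nat.find_min' hex ⟨c, hrc⟩
  generalize Nat.find hex = i at hc hmin
  have hci : c < p i := h.lt_of_pos (by omega)
  have hlast : e i (p i - 1) = L + 1 := by
    have h1 := h.row_weak i c (p i - 1) (by omega) (by omega)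
    have h2 := h.le hp hμ i (p i - 1)
    omega
  refine ⟨i, fun r c => if r = i ∧ c = p i - 1 then 0 else e r c, ?_, hlast, hmin, by simp,
    fun r c hrc => (if_neg hrc).symm⟩
  by_contra! hge
  have h1 := h.col_strict i (i + 1) (p i - 1) (by omega) (by omega)
  have h2 := h.le hp hμ (i + 1) (p i - 1)
  omega

lemma nonempty_ssyt_equiv (hp : IsPartition p) (hL : 1 ≤ μ L) (hμ : ∀ i, L < i → μ i = 0) (j : ℕ) :
    Nonempty ({e // IsSSYT p μ e ∧ ∀ r c, e r c = L + 1 → j ≤ r} ≃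
      Σ i : {i // j ≤ i ∧ p (i + 1) < p i},
        {e // IsSSYT (dec p i) (dec μ L) e ∧ ∀ r c, e r c = L + 1 → i ≤ r}) := by
  refine nonempty_equiv_of_rel (fun a b => Removes p L b.1 a.1 b.2.1) ?_ ?_ ?_ ?_
  · rintro ⟨e, he, hj⟩
    obtain ⟨i, e', hi, hR⟩ := he.exists_removes hp hL hμ
    exact ⟨⟨⟨i, hj _ _ hR.last, hi⟩, e', hR.isSSYT_right he hp hi hL, hR.rows'⟩, hR⟩
  · rintro ⟨⟨i, hj, hi⟩, e', he', hrow⟩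
    have hR : Removes p L i (fun r c => if r = i ∧ c = p i - 1 then L + 1 else e' r c) e' := by
      refine ⟨by simp, fun r c hrc => ?_, he'.zero_outside _ _ (by simp [dec_apply]),
        fun r c hrc => if_neg hrc⟩
      split_ifs at hrc with h
      · exact h.1.ge
      · exact hrow r c hrc
    exact ⟨⟨_, hR.isSSYT_left he' hp hi hL hμ, fun r c h => hj.trans (hR.rows r c h)⟩, hR⟩
  · rintro ⟨e, he, hj⟩ ⟨⟨i, hi⟩, e', he'⟩ ⟨⟨i', hi'⟩, e'', he''⟩ h h'
    simp only at h h'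
    obtain rfl : i = i' := le_antisymm (h.rows _ _ h'.last) (h'.rows _ _ h.last)
    obtain rfl : e' = e'' := by
      funext r c
      by_cases hrc : r = i ∧ c = p i - 1
      · rw [hrc.1, hrc.2, h.zero, h'.zero]
      · rw [← h.eq r c hrc, h'.eq r c hrc]
    rfl
  · rintro ⟨e, he, hj⟩ ⟨e₂, he₂, hj₂⟩ ⟨⟨i, hi⟩, e', he'⟩ h h'
    simp only at h h'
    obtain rfl : e = e₂ := by
      funext r c
      by_cases hrc : r = i ∧ c = p i - 1
      · rw [hrc.1, hrc.2, h.last, h'.last]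
      · rw [h.eq r c hrc, h'.eq r c hrc]
    rfl

end Tableau

section Induction

variable {B L : ℕ} {p μ : ℕ → ℕ} {M : Multiset (ℕ × ℕ)}

/-- The strings at level `0`: one for each of the first `L` parts of `μ`. -/
def baseStrings (μ : ℕ → ℕ) (L : ℕ) : Multiset (ℕ × ℕ) :=
  (Multiset.range L).map fun i => (μ i, 0)

lemma baseStrings_succ (μ : ℕ → ℕ) (L : ℕ) :
    baseStrings μ (L + 1) = (μ L, 0) ::ₘ baseStrings μ L := by
  simp [baseStrings, Multiset.range_succ]

lemma baseStrings_dec (μ : ℕ → ℕ) (L : ℕ) : baseStrings (dec μ L) L = baseStrings μ L := by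
  refine Multiset.map_congr rfl fun i hi => ?_
  rw [dec_apply, if_neg (Multiset.mem_range.1 hi).ne]

lemma IsRC.congr {M' : Multiset (ℕ × ℕ)} {X Y : ℕ → Multiset (ℕ × ℕ)} (h : IsRC B p M X)
    (hY : Y 0 = M') (hq : ∀ n, qsum (Y 0) n = qsum (X 0) n) (hl : len (Y 0) = len (X 0))
    (hs : ∀ k, Y (k + 1) = X (k + 1)) : IsRC B p M' Y := by
  have hv : ∀ k n, vac Y k n = vac X k n := fun k n => by
    rcases k with _ | k
    · simp only [vac, hq, hs]
    · simp only [vac, hs]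
  refine ⟨hY, fun k => by rw [hs, h.card], fun k => ?_, fun k n => by rw [hv]; exact h.nonneg k n,
    fun k x hx => by rw [hv]; rw [hs] at hx; exact h.rig k x hx⟩
  rcases k with _ | k
  · rw [hl, h.size]
  · rw [hs, h.size]

lemma nonempty_rc_cons_zero_equiv (B : ℕ) (p : ℕ → ℕ) (M : Multiset (ℕ × ℕ)) :
    Nonempty ({X // IsRC B p ((0, 0) ::ₘ M) X} ≃ {X // IsRC B p M X}) := by
  have hext : ∀ X Y : ℕ → Multiset (ℕ × ℕ), X 0 = Y 0 → (∀ k, X (k + 1) = Y (k + 1)) → X = Y :=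
    fun X Y h0 hs => funext fun k => by
      rcases k with _ | k
      · exact h0
      · exact hs k
  refine nonempty_equiv_of_rel (fun X Y => ∀ k, X.1 (k + 1) = Y.1 (k + 1)) ?_ ?_ ?_ ?_
  · rintro ⟨X, hX⟩
    exact ⟨⟨fun k => if k = 0 then M else X k, hX.congr (by simp) (by simp [hX.base])
      (by simp [hX.base]) (by simp)⟩, by simp⟩
  · rintro ⟨Y, hY⟩
    exact ⟨⟨fun k => if k = 0 then (0, 0) ::ₘ M else Y k, hY.congr (by simp) (by simp [hY.base])
      (by simp [hY.base]) (by simp)⟩, by simp⟩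
  · exact fun X Y Y' h h' => Subtype.ext
      (hext _ _ (by rw [Y.2.base, Y'.2.base]) fun k => (h k).symm.trans (h' k))
  · exact fun X X' Y h h' => Subtype.ext
      (hext _ _ (by rw [X.2.base, X'.2.base]) fun k => (h k).trans (h' k).symm)

lemma nonempty_reach_equiv (hp : IsPartition p) (hB : tailsum p 0 < B)
    (ih : ∀ p μ : ℕ → ℕ, IsPartition p → (∀ i, L ≤ i → μ i = 0) → tailsum p 0 < B →
      Nonempty ({e // IsSSYT p μ e} ≃ {X // IsRC B p (baseStrings μ L) X}))
    (hμ : ∀ i, L < i → μ i = 0) (j : ℕ) :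
    Nonempty ({e // IsSSYT p μ e ∧ ∀ r c, e r c = L + 1 → j ≤ r} ≃
      {X // IsRC B p ((μ L, 0) ::ₘ baseStrings μ L) X ∧ Reach (Sing X) (μ L) j}) := by
  induction hr : μ L generalizing p μ j with
  | zero =>
    have hμ' : ∀ i, L ≤ i → μ i = 0 := fun i hi => by
      rcases hi.eq_or_lt with rfl | hi
      · exact hr
      · exact hμ i hi
    obtain ⟨f⟩ := ih p μ hp hμ' hB
    obtain ⟨g⟩ := nonempty_rc_cons_zero_equiv B p (baseStrings μ L)
    refine ⟨(Equiv.subtypeEquivRight fun e => ?_).trans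
      ((f.trans g.symm).trans (Equiv.subtypeEquivRight fun X => ?_))⟩
    · refine and_iff_left_of_imp fun he r c hrc => ?_
      have := he.content_pos hp hrc
      omega
    · refine (and_iff_left_of_imp fun hX => ⟨fun _ => 0, rfl, fun k _ => ⟨le_rfl, ?_⟩⟩).symm
      exact hX.sing_zero ((tailsum_anti hp (Nat.zero_le _)).trans_lt hB)
  | succ r IH =>
    obtain ⟨f⟩ := nonempty_ssyt_equiv hp (by omega : 1 ≤ μ L) hμ j
    obtain ⟨g⟩ := nonempty_rc_equiv (B := B) hp (by omega : 1 ≤ r + 1) (baseStrings μ L) j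
    have key : ∀ i : {i // j ≤ i ∧ p (i + 1) < p i},
        Nonempty ({e // IsSSYT (dec p i) (dec μ L) e ∧ ∀ r c, e r c = L + 1 → i ≤ r} ≃
          {Y // IsRC B (dec p i) ((r + 1 - 1, 0) ::ₘ baseStrings μ L) Y ∧
            Reach (Sing Y) (r + 1 - 1) i}) := fun i => by
      have := IH (p := dec p i) (μ := dec μ L) (isPartition_dec hp i.2.2)
        ((Nat.le_of_add_right_le (tailsum_dec hp i.2.2 0).ge).trans_lt hB)
        (fun m hm => by rw [dec_apply, if_neg (by omega), hμ m hm]) i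
        (by rw [dec_apply, if_pos rfl]; omega)
      rwa [baseStrings_dec] at this
    exact ⟨f.trans ((Equiv.sigmaCongrRight fun i => (key i).some).trans g.symm)⟩

lemma nonempty_equiv_of_content_zero (hp : IsPartition p) (hμ : ∀ i, μ i = 0) :
    Nonempty ({e // IsSSYT p μ e} ≃ {X // IsRC B p 0 X}) := by
  have hzero : p 0 = 0 → ∀ i, p i = 0 := fun h i =>
    Nat.le_zero.1 ((hp.antitone (Nat.zero_le i)).trans h.le)
  have hE : ∀ e, IsSSYT p μ e → p 0 = 0 ∧ e = fun _ _ => 0 := fun e he => by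
    have h0 : e = fun _ _ => 0 := by
      funext r c
      by_contra h
      have := he.content_pos hp (r := r) (c := c) (m := e r c - 1) (by omega)
      rw [hμ] at this
      omega
    refine ⟨by_contra fun h => ?_, h0⟩
    have := he.pos 0 0 (by omega)
    simp [h0] at this
  have hX : ∀ X, IsRC B p 0 X →
      p 0 = 0 ∧ X = fun k => if k = 0 then 0 else Multiset.replicate B (0, 0) := fun X h => by
    have ht : tailsum p 0 = 0 := by rw [← h.size, h.base]; rfl
    refine ⟨by rw [tailsum_succ hp] at ht; omega, funext fun k => ?_⟩
    rcases k with _ | k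
    · simpa using h.base
    · rw [if_neg (by omega)]
      refine Multiset.eq_replicate.2 ⟨h.card k, fun x hx => ?_⟩
      have h1 := fst_le_len hx
      have h2 := h.rig k x hx
      have h3 := tailsum_anti hp (Nat.zero_le (k + 1))
      rw [h.size] at h1
      have h4 : x.1 = 0 := by omega
      rw [h4, vac_zero] at h2
      exact Prod.ext h4 (by simpa using h2)
  refine nonempty_equiv_of_rel (fun _ _ => True) ?_ ?_ ?_ ?_
  · rintro ⟨e, he⟩
    have hp0 := hzero (hE e he).1
    have hq : ∀ k n, qsum (if k = 0 then 0 else Multiset.replicate B (0, 0)) n = 0 :=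
      fun k n => by split_ifs <;> simp [qsum]
    refine ⟨⟨fun k => if k = 0 then 0 else Multiset.replicate B (0, 0), rfl, by simp, fun k => ?_,
      fun k n => by simp only [vac, hq]; norm_num, fun k x hx => ?_⟩, trivial⟩
    · rw [tailsum_eq_zero fun i _ => hp0 i]
      split_ifs <;> simp [len]
    · rw [if_neg (by omega)] at hx
      rw [Multiset.eq_of_mem_replicate hx]
      simp [vac_zero]
  · rintro ⟨X, h⟩
    have hp0 := hzero (hX X h).1
    exact ⟨⟨fun _ _ => 0, fun r c hc => by rw [hp0] at hc; omega, by simp,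
      fun _ r c _ hc => by rw [hp0] at hc; omega, by simp, fun i => by simp [hμ]⟩, trivial⟩
  · exact fun _ X Y _ _ => Subtype.ext ((hX _ X.2).2.trans (hX _ Y.2).2.symm)
  · exact fun e e' _ _ _ => Subtype.ext ((hE _ e.2).2.trans (hE _ e'.2).2.symm)

/-- Tableaux of shape `p` and content `μ` correspond to rigged configurations. -/
theorem nonempty_ssyt_equiv_rc (hp : IsPartition p) (hμ : ∀ i, L ≤ i → μ i = 0)
    (hB : tailsum p 0 < B) :
    Nonempty ({e // IsSSYT p μ e} ≃ {X // IsRC B p (baseStrings μ L) X}) := by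
  induction L generalizing p μ with
  | zero => exact nonempty_equiv_of_content_zero hp fun i => hμ i (Nat.zero_le i)
  | succ L ih =>
    obtain ⟨f⟩ := nonempty_reach_equiv (μ := μ) hp hB (fun p μ => ih) (fun i hi => hμ i hi) 0
    rw [← baseStrings_succ] at f
    refine ⟨(Equiv.subtypeEquivRight fun e => ?_).trans
      (f.trans (Equiv.subtypeEquivRight fun X => ?_))⟩
    · simp
    · exact and_iff_left ⟨fun _ => μ L, rfl, by simp⟩

end Induction

section Counting

/-- Multisets of strings with lengths `W` and riggings bounded by `P`. -/
abbrev Rigging (W : Multiset ℕ) (P : ℕ → ℕ) : Type :=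
  {S : Multiset (ℕ × ℕ) // S.map Prod.fst = W ∧ ∀ x ∈ S, x.2 ≤ P x.1}

lemma card_rigging_replicate (m T : ℕ) (P : ℕ → ℕ) :
    Nat.card (Rigging (Multiset.replicate m T) P) = (P T + m).choose m := by
  have hinj : Function.Injective fun i : Fin (P T + 1) => (T, (i : ℕ)) := fun i j h =>
    Fin.ext (Prod.ext_iff.1 h).2
  let f : Sym (Fin (P T + 1)) m → Rigging (Multiset.replicate m T) P := fun s =>
    ⟨s.1.map fun i : Fin (P T + 1) => (T, (i : ℕ)), by simp, by
      simp only [Multiset.mem_map]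
      rintro _ ⟨i, -, rfl⟩
      exact Nat.lt_succ_iff.1 i.2⟩
  have hf : Function.Bijective f := by
    refine ⟨fun s t h => Subtype.ext (Multiset.map_injective hinj (Subtype.ext_iff.1 h)), ?_⟩
    rintro ⟨S, hS, hP⟩
    have hT : ∀ x ∈ S, x.1 = T := fun x hx =>
      Multiset.eq_of_mem_replicate (hS ▸ Multiset.mem_map_of_mem _ hx)
    refine ⟨⟨S.map fun x => Fin.ofNat (P T + 1) x.2, ?_⟩, Subtype.ext ?_⟩
    · rw [Multiset.card_map, ← Multiset.card_map Prod.fst, hS, Multiset.card_replicate]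
    · refine (Multiset.map_map _ _ _).trans (Eq.trans ?_ (Multiset.map_id S))
      refine Multiset.map_congr rfl fun x hx => ?_
      have h1 := hP x hx
      rw [hT x hx] at h1
      exact Prod.ext (hT x hx).symm (Nat.mod_eq_of_lt (Nat.lt_succ_iff.2 h1))
  rw [← Nat.card_congr (Equiv.ofBijective f hf), Nat.card_eq_fintype_card,
    Sym.card_sym_fin_eq_multichoose, Nat.multichoose_eq, Nat.add_right_comm, Nat.add_sub_cancel]

lemma card_rigging_add {W V : Multiset ℕ} (q : ℕ → Prop) (hW : ∀ n ∈ W, q n)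
    (hV : ∀ n ∈ V, ¬ q n) (P : ℕ → ℕ) :
    Nat.card (Rigging (W + V) P) = Nat.card (Rigging W P) * Nat.card (Rigging V P) := by
  classical
  have hfilter : ∀ S : Multiset (ℕ × ℕ), (S.filter fun x => q x.1).map Prod.fst =
      (S.map Prod.fst).filter q := fun S => by rw [Multiset.filter_map]; rfl
  have hfilter' : ∀ S : Multiset (ℕ × ℕ), (S.filter fun x => ¬ q x.1).map Prod.fst =
      (S.map Prod.fst).filter fun n => ¬ q n := fun S => by rw [Multiset.filter_map]; rfl
  have hW1 : W.filter q = W := Multiset.filter_eq_self.2 hW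
  have hW2 : (W.filter fun n => ¬ q n) = 0 := Multiset.filter_eq_nil.2 fun n hn => not_not.2 (hW n hn)
  have hV1 : V.filter q = 0 := Multiset.filter_eq_nil.2 hV
  have hV2 : (V.filter fun n => ¬ q n) = V := Multiset.filter_eq_self.2 hV
  rw [← Nat.card_prod]
  refine Nat.card_congr
    { toFun := fun S => (⟨S.1.filter fun x => q x.1, ?_, fun x hx => ?_⟩,
        ⟨S.1.filter fun x => ¬ q x.1, ?_, fun x hx => ?_⟩)
      invFun := fun S => ⟨S.1.1 + S.2.1, ?_, fun x hx => ?_⟩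
      left_inv := fun S => Subtype.ext (Multiset.filter_add_not _ _)
      right_inv := fun S => ?_ }
  · rw [hfilter, S.2.1, Multiset.filter_add, hW1, hV1, add_zero]
  · exact S.2.2 x (Multiset.mem_of_mem_filter hx)
  · rw [hfilter', S.2.1, Multiset.filter_add, hW2, hV2, zero_add]
  · exact S.2.2 x (Multiset.mem_of_mem_filter hx)
  · rw [Multiset.map_add, S.1.2.1, S.2.2.1]
  · rcases Multiset.mem_add.1 hx with hx | hx
    · exact S.1.2.2 x hx
    · exact S.2.2.2 x hx
  · obtain ⟨⟨S, hS, _⟩, ⟨S', hS', _⟩⟩ := S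
    have h1 : ∀ x ∈ S, q x.1 := fun x hx => hW _ (hS ▸ Multiset.mem_map_of_mem _ hx)
    have h2 : ∀ x ∈ S', ¬ q x.1 := fun x hx => hV _ (hS' ▸ Multiset.mem_map_of_mem _ hx)
    refine Prod.ext (Subtype.ext ?_) (Subtype.ext ?_) <;>
      simp only [Multiset.filter_add]
    · rw [Multiset.filter_eq_self.2 h1, Multiset.filter_eq_nil.2 h2, add_zero]
    · rw [Multiset.filter_eq_nil.2 fun x hx => not_not.2 (h1 x hx), Multiset.filter_eq_self.2 h2,
        zero_add]

lemma card_rigging {W : Multiset ℕ} {T : ℕ} (hW : ∀ n ∈ W, n < T) (P : ℕ → ℕ) :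
    Nat.card (Rigging W P) = ∏ n ∈ Finset.range T, (P n + W.count n).choose (W.count n) := by
  induction T generalizing W with
  | zero =>
    obtain rfl : W = Multiset.replicate 0 0 :=
      Multiset.eq_zero_of_forall_notMem fun n hn => Nat.not_lt_zero n (hW n hn)
    rw [card_rigging_replicate]
    simp
  | succ T ih =>
    have hrep : (W.filter fun n => ¬ n < T) = Multiset.replicate (W.count T) T := by
      rw [← Multiset.filter_eq']
      refine Multiset.filter_congr fun n hn => ?_
      have := hW n hn
      omega
    have hlt : ∀ n ∈ W.filter fun n => n < T, n < T := fun n hn => (Multiset.mem_filter.1 hn).2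
    conv_lhs => rw [← Multiset.filter_add_not (fun n => n < T) W]
    rw [card_rigging_add (fun n => n < T) hlt (fun n hn => (Multiset.mem_filter.1 hn).2), hrep,
      card_rigging_replicate, ih hlt, Finset.prod_range_succ]
    congr 1
    refine Finset.prod_congr rfl fun n hn => ?_
    rw [Multiset.count_filter_of_pos (p := fun n => n < T) (Finset.mem_range.1 hn)]

lemma card_rigging_eq_finprod (W : Multiset ℕ) {P : ℕ → ℕ} (hP : P 0 = 0) :
    Nat.card (Rigging W P) =
      ∏ᶠ n, (P (n + 1) + W.count (n + 1)).choose (W.count (n + 1)) := by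
  have hle : ∀ n ∈ W, n < W.sum + 1 := fun n hn => Nat.lt_succ_iff.2 (Multiset.le_sum_of_mem hn)
  rw [card_rigging hle, Finset.prod_range_succ', hP, zero_add, Nat.choose_self, mul_one]
  refine (finprod_eq_prod_of_mulSupport_subset _ fun n hn => ?_).symm
  by_contra hlt
  simp only [Finset.coe_range, Set.mem_Iio, not_lt] at hlt
  refine hn ?_
  simp only
  rw [Multiset.count_eq_zero.2 fun h => ?_, Nat.choose_zero_right]
  have := hle _ h
  omega

lemma card_pi_eq_finprod {F : ℕ → Type*} {K : ℕ} (hF : ∀ k, K ≤ k → Nat.card (F k) = 1) :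
    Nat.card (∀ k, F k) = ∏ᶠ k, Nat.card (F k) := by
  have hu := fun k hk => Nat.card_eq_one_iff_unique.1 (hF k hk)
  have hb : Function.Bijective fun (f : ∀ k, F k) (k : Fin K) => f k := by
    refine ⟨fun f g h => funext fun k => ?_, fun g => ?_⟩
    · rcases Nat.lt_or_ge k K with hk | hk
      · exact congrFun h ⟨k, hk⟩
      · exact (hu k hk).1.elim _ _
    · exact ⟨fun k => if hk : k < K then g ⟨k, hk⟩ else (hu k (not_lt.1 hk)).2.some,
        funext fun k => dif_pos k.2⟩
  rw [Nat.card_congr (Equiv.ofBijective _ hb), Nat.card_pi,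
    Fin.prod_univ_eq_prod_range (fun k => Nat.card (F k))]
  refine (finprod_eq_prod_of_mulSupport_subset _ fun k hk => ?_).symm
  by_contra hlt
  simp only [Finset.coe_range, Set.mem_Iio, not_lt] at hlt
  exact hk (hF k hlt)

end Counting

section Statistics

variable {q : ℕ → ℕ} {N : ℕ}

/-- The parts `q 0, …, q (N - 1)` as a multiset. -/
def parts (q : ℕ → ℕ) (N : ℕ) : Multiset ℕ := (Multiset.range N).map q

lemma sum_parts (hq : ∀ i, N ≤ i → q i = 0) : (parts q N).sum = psize q := by
  refine (finsum_eq_sum_of_support_subset (s := Finset.range N) _ fun i hi => ?_).symm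
  by_contra h
  simp only [Finset.coe_range, Set.mem_Iio, not_lt] at h
  exact hi (hq _ h)

lemma conj_eq_card (hq : ∀ i, N ≤ i → q i = 0) (n : ℕ) :
    conj q (n + 1) = ((Finset.range N).filter fun i => n + 1 ≤ q i).card := by
  rw [conj, Nat.card_coe_set_eq, ← Set.ncard_coe_finset]
  congr 1
  ext i
  simp only [Set.mem_ofPred_eq, Finset.coe_filter, Finset.mem_range, iff_and_self]
  intro h
  by_contra! hN
  have := hq i hN
  omega

lemma Qstat_eq_sum (hq : ∀ i, N ≤ i → q i = 0) (n : ℕ) :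
    Qstat q n = ∑ i ∈ Finset.range N, min (q i) n := by
  induction n with
  | zero => simp [Qstat]
  | succ n ih =>
    have hs : Qstat q (n + 1) = Qstat q n + conj q (n + 1) := by
      rw [Qstat, Finset.sum_Icc_succ_top (by omega)]
      rfl
    rw [hs, ih, conj_eq_card hq, Finset.card_filter, ← Finset.sum_add_distrib]
    refine Finset.sum_congr rfl fun i _ => ?_
    split_ifs <;> omega

lemma mstat_eq_count (hq : ∀ i, N ≤ i → q i = 0) (n : ℕ) :
    mstat q (n + 1) = (parts q N).count (n + 1) := by
  have hc : (parts q N).count (n + 1) = ((Finset.range N).filter fun i => n + 1 = q i).card := by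
    rw [parts, Multiset.count_map]
    rfl
  rw [mstat, conj_eq_card hq, conj_eq_card hq, hc, Finset.card_filter, Finset.card_filter,
    Finset.card_filter, Nat.sub_eq_iff_eq_add, ← Finset.sum_add_distrib]
  · refine Finset.sum_congr rfl fun i _ => ?_
    split_ifs <;> omega
  · refine Finset.sum_le_sum fun i _ => ?_
    split_ifs <;> omega

lemma qsum_eq_Qstat (hq : ∀ i, N ≤ i → q i = 0) {S : Multiset (ℕ × ℕ)}
    (hS : S.map Prod.fst = parts q N) (n : ℕ) : qsum S n = Qstat q n := by
  have h : qsum S n = ((S.map Prod.fst).map fun a => ((min a n : ℕ) : ℤ)).sum := by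
    rw [Multiset.map_map]
    rfl
  rw [h, hS, parts, Multiset.map_map, Qstat_eq_sum hq, Nat.cast_sum]
  rfl

lemma len_eq_psize (hq : ∀ i, N ≤ i → q i = 0) {S : Multiset (ℕ × ℕ)}
    (hS : S.map Prod.fst = parts q N) : len S = psize q := by
  rw [len, hS, sum_parts hq]

lemma exists_partition (W : Multiset ℕ) :
    ∃ q, IsPartition q ∧ (∀ i, W.card ≤ i → q i = 0) ∧ parts q W.card = W := by
  have hlen : (W.sort (· ≥ ·)).length = W.card := Multiset.length_sort _
  have hz : ∀ i, W.card ≤ i → (W.sort (· ≥ ·)).getD i 0 = 0 := fun i hi =>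
    List.getD_eq_default _ _ (by omega)
  refine ⟨fun i => (W.sort (· ≥ ·)).getD i 0, ⟨fun i => ?_, W.card, hz _ le_rfl⟩, hz, ?_⟩
  · beta_reduce
    rcases Nat.lt_or_ge (i + 1) W.card with hi | hi
    · rw [List.getD_eq_getElem _ _ (by omega), List.getD_eq_getElem _ _ (by omega)]
      exact List.pairwise_iff_getElem.1 (W.pairwise_sort (· ≥ ·)) i (i + 1) (by omega) (by omega)
        (by omega)
    · rw [hz _ hi]
      exact Nat.zero_le _
  · conv_rhs => rw [← W.sort_eq (· ≥ ·)]
    rw [parts, Multiset.range, Multiset.map_coe]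
    congr 1
    refine List.ext_getElem (by simp [hlen]) fun i h1 h2 => ?_
    rw [List.getElem_map, List.getElem_range, List.getD_eq_getElem _ _ h2]

lemma partition_ext {q' : ℕ → ℕ} (hq : IsPartition q) (hq' : IsPartition q')
    (hN : ∀ i, N ≤ i → q i = 0) (hN' : ∀ i, N ≤ i → q' i = 0) (h : parts q N = parts q' N) :
    q = q' := by
  have hs : ∀ q, IsPartition q → ((List.range N).map q).Pairwise (· ≥ ·) := fun q hq => by
    rw [List.pairwise_map]
    exact List.pairwise_lt_range.imp fun hab => hq.antitone hab.le
  have hl : (List.range N).map q = (List.range N).map q' :=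
    (Multiset.coe_eq_coe.1 h).eq_of_pairwise (fun a b _ _ h1 h2 => le_antisymm h2 h1)
      (hs q hq) (hs q' hq')
  funext i
  rcases Nat.lt_or_ge i N with hi | hi
  · exact List.map_inj_left.1 hl i (List.mem_range.2 hi)
  · rw [hN i hi, hN' i hi]

lemma eq_zero_of_psize_lt (hq : IsPartition q) (h : psize q < N) (i : ℕ) (hi : N ≤ i) : q i = 0 := by
  obtain ⟨K, hK⟩ := hq.exists_zero
  by_contra hne
  have hiK : N ≤ K := by
    by_contra! hlt
    exact hne (hK i (by omega))
  have h1 : ∑ i ∈ Finset.range N, 1 ≤ ∑ i ∈ Finset.range K, q i :=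
    (Finset.sum_le_sum fun a ha => by
      have := Finset.mem_range.1 ha
      have := hq.antitone (show a ≤ i by omega)
      omega).trans (Finset.sum_le_sum_of_subset (Finset.range_mono hiK))
  have h2 : ∑ i ∈ Finset.range K, q i = psize q := sum_parts hK
  simp at h1
  omega

end Statistics

section Configurations

variable {p μ : ℕ → ℕ} {L B : ℕ}

lemma baseStrings_fst (μ : ℕ → ℕ) (L : ℕ) : (baseStrings μ L).map Prod.fst = parts μ L := by
  rw [baseStrings, Multiset.map_map]
  rfl

lemma vac_eq_Pconf {ν : ℕ → ℕ → ℕ} {X : ℕ → Multiset (ℕ × ℕ)}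
    (h : ∀ k, ∃ N, (∀ i, N ≤ i → ν k i = 0) ∧ (X k).map Prod.fst = parts (ν k) N) (k n : ℕ) :
    vac X k n = Pconf ν (k + 1) n := by
  have hq : ∀ k, qsum (X k) n = Qstat (ν k) n := fun k =>
    let ⟨_, h1, h2⟩ := h k
    qsum_eq_Qstat h1 h2 n
  simp only [vac, hq]
  rfl

lemma Pconf_zero (ν : ℕ → ℕ → ℕ) (k : ℕ) : Pconf ν k 0 = 0 := by
  simp [Pconf, Qstat]

lemma _root_.IsConfig.eq_zero {ν : ℕ → ℕ → ℕ} (hν : IsConfig p μ ν) (hp : IsPartition p)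
    (hB : tailsum p 0 < B) (k i : ℕ) (hi : B ≤ i) : ν (k + 1) i = 0 := by
  refine eq_zero_of_psize_lt (hν.2.1 (k + 1) (by omega)) ?_ i hi
  rw [hν.2.2.1 (k + 1) (by omega)]
  exact (tailsum_anti hp (Nat.zero_le _)).trans_lt hB

lemma IsRC.exists_isConfig {X : ℕ → Multiset (ℕ × ℕ)} (h : IsRC B p (baseStrings μ L) X)
    (hμ : ∀ i, L ≤ i → μ i = 0) :
    ∃ ν, IsConfig p μ ν ∧ (∀ k, (X (k + 1)).map Prod.fst = parts (ν (k + 1)) B) ∧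
      ∀ k n, vac X k n = Pconf ν (k + 1) n := by
  choose q hq hq0 hqX using fun k => exists_partition ((X (k + 1)).map Prod.fst)
  simp only [Multiset.card_map, h.card] at hq0 hqX
  let ν : ℕ → ℕ → ℕ := fun k => Nat.casesOn k μ q
  have hX : ∀ k, ∃ N, (∀ i, N ≤ i → ν k i = 0) ∧ (X k).map Prod.fst = parts (ν k) N := fun k => by
    rcases k with _ | k
    · exact ⟨L, hμ, (congrArg _ h.base).trans (baseStrings_fst μ L)⟩
    · exact ⟨B, hq0 k, (hqX k).symm⟩
  refine ⟨ν, ⟨rfl, fun k hk => ?_, fun k hk => ?_, fun k n hk hn => ?_⟩, fun k => (hqX k).symm,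
    vac_eq_Pconf hX⟩ <;> obtain ⟨k, rfl⟩ : ∃ i, k = i + 1 := ⟨k - 1, by omega⟩
  · exact hq k
  · rw [← h.size, len_eq_psize (hq0 k) (hqX k).symm]
  · rw [← vac_eq_Pconf hX]
    exact h.nonneg k n

lemma _root_.IsConfig.isRC {ν : ℕ → ℕ → ℕ} {X : ℕ → Multiset (ℕ × ℕ)} (hν : IsConfig p μ ν)
    (hp : IsPartition p) (hB : tailsum p 0 < B) (hμ : ∀ i, L ≤ i → μ i = 0)
    (hsize : psize μ = psize p) (hX0 : X 0 = baseStrings μ L)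
    (hX : ∀ k, (X (k + 1)).map Prod.fst = parts (ν (k + 1)) B)
    (hrig : ∀ k, ∀ x ∈ X (k + 1), x.2 ≤ (Pconf ν (k + 1) x.1).toNat) :
    IsRC B p (baseStrings μ L) X := by
  have hshape : ∀ k, ∃ N, (∀ i, N ≤ i → ν k i = 0) ∧ (X k).map Prod.fst = parts (ν k) N :=
    fun k => by
      rcases k with _ | k
      · exact ⟨L, by rwa [hν.1], by rw [hX0, baseStrings_fst, hν.1]⟩
      · exact ⟨B, hν.eq_zero hp hB k, hX k⟩
  have hv := vac_eq_Pconf hshape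
  have hnn : ∀ k n, 0 ≤ vac X k n := fun k n => by
    rcases n with _ | n
    · rw [vac_zero]
    · rw [hv]
      exact hν.2.2.2 _ _ (by omega) (by omega)
  refine ⟨hX0, fun k => ?_, fun k => ?_, hnn, fun k x hx => ?_⟩
  · rw [← Multiset.card_map Prod.fst, hX, parts, Multiset.card_map, Multiset.card_range]
  · obtain ⟨N, h1, h2⟩ := hshape k
    rw [len_eq_psize h1 h2]
    rcases k with _ | k
    · rw [hν.1, hsize]
      rfl
    · exact hν.2.2.1 _ (by omega)
  · have h1 := hrig k x hx
    have h2 := hnn k x.1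
    rw [hv] at h2 ⊢
    omega

/-- A rigged configuration is a configuration together with a rigging on each level. -/
lemma nonempty_rc_equiv_sigma (hp : IsPartition p) (hB : tailsum p 0 < B)
    (hμ : ∀ i, L ≤ i → μ i = 0) (hsize : psize μ = psize p) :
    Nonempty ({X // IsRC B p (baseStrings μ L) X} ≃ Σ ν : {ν | IsConfig p μ ν},
      ∀ k, Rigging (parts (ν.1 (k + 1)) B) fun n => (Pconf ν.1 (k + 1) n).toNat) := by
  refine nonempty_equiv_of_rel (fun X b => ∀ k, X.1 (k + 1) = (b.2 k).1) ?_ ?_ ?_ ?_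
  · rintro ⟨X, h⟩
    obtain ⟨ν, hν, hX, hv⟩ := h.exists_isConfig hμ
    refine ⟨⟨⟨ν, hν⟩, fun k => ⟨X (k + 1), hX k, fun x hx => ?_⟩⟩, fun k => rfl⟩
    have := h.rig k x hx
    rw [hv] at this
    exact Int.le_toNat (Int.natCast_nonneg _ |>.trans this) |>.2 this
  · rintro ⟨⟨ν, hν⟩, f⟩
    exact ⟨⟨fun k => Nat.casesOn k (baseStrings μ L) fun k => (f k).1,
      hν.isRC hp hB hμ hsize rfl (fun k => (f k).2.1) fun k => (f k).2.2⟩, fun k => rfl⟩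
  · rintro X ⟨⟨ν, hν⟩, f⟩ ⟨⟨ν', hν'⟩, f'⟩ h h'
    obtain rfl : ν = ν' := by
      funext k
      rcases k with _ | k
      · rw [hν.1, hν'.1]
      · refine partition_ext (hν.2.1 _ (by omega)) (hν'.2.1 _ (by omega)) (hν.eq_zero hp hB k)
          (hν'.eq_zero hp hB k) ?_
        rw [← (f k).2.1, ← (f' k).2.1, ← h k, h' k]
    obtain rfl : f = f' := funext fun k => Subtype.ext ((h k).symm.trans (h' k))
    rfl
  · refine fun X X' b h h' => Subtype.ext (funext fun k => ?_)
    rcases k with _ | k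
    · rw [X.2.base, X'.2.base]
    · exact (h k).trans (h' k).symm

lemma _root_.IsConfig.card_riggings {ν : ℕ → ℕ → ℕ} (hν : IsConfig p μ ν) (hp : IsPartition p)
    (hB : tailsum p 0 < B) :
    Nat.card (∀ k, Rigging (parts (ν (k + 1)) B) fun n => (Pconf ν (k + 1) n).toNat) =
      ∏ᶠ (k : ℕ) (n : ℕ), Nat.choose ((Pconf ν (k + 1) (n + 1)).toNat + mstat (ν (k + 1)) (n + 1))
        (mstat (ν (k + 1)) (n + 1)) := by
  have hcard : ∀ k, Nat.card (Rigging (parts (ν (k + 1)) B) fun n => (Pconf ν (k + 1) n).toNat) =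
      ∏ᶠ n : ℕ, Nat.choose ((Pconf ν (k + 1) (n + 1)).toNat + mstat (ν (k + 1)) (n + 1))
        (mstat (ν (k + 1)) (n + 1)) := fun k => by
    rw [card_rigging_eq_finprod _ (by simp [Pconf_zero])]
    simp only [mstat_eq_count (hν.eq_zero hp hB k)]
  obtain ⟨K, hK⟩ := hp.exists_zero
  rw [card_pi_eq_finprod (K := K) fun k hk => ?_]
  · simp only [hcard]
  · have hz := hν.eq_zero hp hB k
    have hs : (parts (ν (k + 1)) B).sum = 0 := by
      rw [sum_parts hz, hν.2.2.1 _ (by omega), tailsum_eq_zero fun i hi => hK i (by omega)]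
    have hm : ∀ n, mstat (ν (k + 1)) (n + 1) = 0 := fun n => by
      rw [mstat_eq_count hz, Multiset.count_eq_zero]
      intro h
      have := Multiset.le_sum_of_mem h
      omega
    simp [hcard, hm]

lemma finite_ssyt (hp : IsPartition p) (hμ : ∀ i, L ≤ i → μ i = 0) :
    Finite {e // IsSSYT p μ e} := by
  have := (finite_boxes hp).to_subtype
  refine Finite.of_injective
    (fun e (x : {x : ℕ × ℕ | x.2 < p x.1}) => (⟨e.1 x.1.1 x.1.2,
      Nat.lt_succ_iff.2 (e.2.le hp (L := L) (fun i hi => hμ i hi.le) _ _)⟩ : Fin (L + 2))) ?_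
  rintro ⟨e, he⟩ ⟨e', he'⟩ h
  refine Subtype.ext (funext fun r => funext fun c => ?_)
  rcases Nat.lt_or_ge c (p r) with hc | hc
  · exact congrArg Fin.val (congrFun h ⟨(r, c), hc⟩)
  · exact (he.zero_outside r c hc).trans (he'.zero_outside r c hc).symm

/-- Forget the bundling of semistandard tableaux. -/
def ssytEquiv (p μ : ℕ → ℕ) : SSYTContent p μ ≃ {e // IsSSYT p μ e} where
  toFun T := ⟨T.entry, T.pos, T.row_weak, T.col_strict, T.zero_outside, T.content⟩
  invFun e := ⟨e.1, e.2.pos, e.2.row_weak, e.2.col_strict, e.2.zero_outside, e.2.content⟩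
  left_inv _ := rfl
  right_inv _ := rfl

lemma nonempty_riggings (B : ℕ) (ν : ℕ → ℕ → ℕ) (k : ℕ) :
    Nonempty (Rigging (parts (ν (k + 1)) B) fun n => (Pconf ν (k + 1) n).toNat) :=
  ⟨(parts (ν (k + 1)) B).map fun n => (n, 0), by simp, by simp⟩

end Configurations

end RiggedConfig

/-- **Fermionic formula for Kostka numbers.** For a partition `λ` and a composition `μ`
with `|μ| = |λ|`, the Kostka number `K_{λ,μ}` (the number of semistandard Young tableaux of
shape `λ` and content `μ`) equals
`∑_{ν} ∏_{k,n ≥ 1} C(P_n^{(k)}(λ,μ) + m_n(ν^{(k)}), m_n(ν^{(k)}))`, the sum over all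
configurations `{ν}` of type `(λ, μ)`. -/
theorem kostka_eq_sum_over_configurations
    (p : ℕ → ℕ) (hp : IsPartition p) (μ : ℕ → ℕ) (hμ : IsComposition μ)
    (hsize : psize μ = psize p) :
    Nat.card (SSYTContent p μ) =
      ∑ᶠ ν ∈ {ν : ℕ → ℕ → ℕ | IsConfig p μ ν},
        ∏ᶠ (k : ℕ) (n : ℕ),
          Nat.choose ((Pconf ν (k + 1) (n + 1)).toNat + mstat (ν (k + 1)) (n + 1))
            (mstat (ν (k + 1)) (n + 1)) := by
  open RiggedConfig in
  obtain ⟨L, hL⟩ := hμ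
  have hB : tailsum p 0 < tailsum p 0 + 1 := Nat.lt_succ_self _
  obtain ⟨f⟩ := nonempty_ssyt_equiv_rc hp hL hB
  obtain ⟨g⟩ := nonempty_rc_equiv_sigma hp hB hL hsize
  have hfin := finite_ssyt hp hL
  have hfinS := Finite.of_equiv _ (f.trans g)
  have hfinR := fun ν : {ν | IsConfig p μ ν} => Finite.of_injective _ (sigma_mk_injective (i := ν)
    (β := fun ν : {ν | IsConfig p μ ν} => ∀ k, Rigging (parts (ν.1 (k + 1)) (tailsum p 0 + 1))
      fun n => (Pconf ν.1 (k + 1) n).toNat))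
  have hfinC : Finite {ν | IsConfig p μ ν} := Finite.of_surjective
    (Sigma.fst (β := fun ν : {ν | IsConfig p μ ν} => ∀ k,
      Rigging (parts (ν.1 (k + 1)) (tailsum p 0 + 1)) fun n => (Pconf ν.1 (k + 1) n).toNat))
    fun ν => ⟨⟨ν, fun k => Classical.choice (nonempty_riggings _ _ k)⟩, rfl⟩
  have := Fintype.ofFinite {ν | IsConfig p μ ν}
  rw [Nat.card_congr (((ssytEquiv p μ).trans f).trans g), Nat.card_sigma,
    ← finsum_set_coe_eq_finsum_mem, finsum_eq_sum_of_fintype]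
  exact Finset.sum_congr rfl fun ν _ => ν.2.card_riggings hp hB
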